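/- Fix 0 < p < 1 and τ ≥ 0, and suppose t(n) is a sequence of nonnegative integers with t(n)/ln n → τ as n → ∞. Then asymptotically almost surely χ^{t(n)}(G(n,p)) = (1 + o(1)) · n/(κ_p(τ)·ln n); that is, for every ε > 0, the probability that (1−ε)·n/(κ_p(τ)·ln n) ≤ χ^{t(n)}(G(n,p)) ≤ (1+ε)·n/(κ_p(τ)·ln n) tends to 1 as n → ∞. -/

import Mathlib

open MeasureTheory Filter
open scoped ENNReal NNReal

/-- The Bernoulli(p) measure on `Bool`. -/
noncomputable def bernoulliBool (p : ℝ) : Measure Bool :=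
  p.toNNReal • Measure.dirac true + (1 - p).toNNReal • Measure.dirac false

instance (p : ℝ) : IsFiniteMeasure (bernoulliBool p) := by
  unfold bernoulliBool; infer_instance

instance (n : ℕ) : MeasurableSpace (SimpleGraph (Fin n)) := ⊤

/-- The Erdős–Rényi random graph `G(n,p)`: the distribution of the simple graph on `Fin n`
obtained by including each possible edge independently with probability `p`. -/
noncomputable def erMeasure (n : ℕ) (p : ℝ) : Measure (SimpleGraph (Fin n)) :=
  Measure.map (fun f : Sym2 (Fin n) → Bool => SimpleGraph.fromEdgeSet {e | f e = true})
    (Measure.pi fun _ : Sym2 (Fin n) => bernoulliBool p)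

/-- A set `S` of vertices is `t`-dependent if the induced subgraph has maximum degree at most `t`,
i.e. every vertex of `S` has at most `t` neighbours inside `S`. -/
def IsTDependent {V : Type*} (G : SimpleGraph V) (t : ℕ) (S : Set V) : Prop :=
  ∀ v ∈ S, {u ∈ S | G.Adj v u}.ncard ≤ t

/-- The `t`-improper chromatic number: the least number of colours in a vertex colouring
in which every colour class is `t`-dependent. -/
noncomputable def improperChromaticNumber {V : Type*} (G : SimpleGraph V) (t : ℕ) : ℕ :=
  sInf {k | ∃ c : V → Fin k, ∀ i : Fin k, IsTDependent G t {v | c v = i}}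

/-- The `t`-dependence number: the maximum size of a `t`-dependent set. -/
noncomputable def tDependenceNumber {V : Type*} (G : SimpleGraph V) (t : ℕ) : ℕ :=
  sSup {m | ∃ S : Set V, S.ncard = m ∧ IsTDependent G t S}

/-- The Fenchel–Legendre transform `Λ*(x) = x ln(x/p) + (1-x) ln((1-x)/(1-p))`
(with the conventions `Λ*(0) = ln(1/(1-p))`, `Λ*(1) = ln(1/p)`, which hold automatically
since `Real.log 0 = 0` in Lean). -/
noncomputable def LambdaStar (p x : ℝ) : ℝ :=
  x * Real.log (x / p) + (1 - x) * Real.log ((1 - x) / (1 - p))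

section ProductBernoulli

open ProbabilityTheory

theorem isProbabilityMeasure_bernoulliBool {p : ℝ} (hp : p ∈ Set.Icc (0 : ℝ) 1) :
    IsProbabilityMeasure (bernoulliBool p) := by
  constructor
  have h : p.toNNReal + (1 - p).toNNReal = 1 := by
    rw [← Real.toNNReal_add hp.1 (by linarith [hp.2])]; simp
  simp only [bernoulliBool, Measure.coe_add, Measure.coe_nnreal_smul_apply, Pi.add_apply,
    measure_univ, mul_one]
  exact_mod_cast h

theorem integral_bernoulliBool {p : ℝ} (hp : p ∈ Set.Icc (0 : ℝ) 1) (f : Bool → ℝ) :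
    ∫ b, f b ∂bernoulliBool p = p * f true + (1 - p) * f false := by
  rw [bernoulliBool, integral_add_measure Integrable.of_finite Integrable.of_finite,
    integral_smul_nnreal_measure, integral_smul_nnreal_measure, integral_dirac, integral_dirac,
    NNReal.smul_def, NNReal.smul_def, Real.coe_toNNReal _ hp.1,
    Real.coe_toNNReal _ (by linarith [hp.2] : (0 : ℝ) ≤ 1 - p), smul_eq_mul, smul_eq_mul]

variable {E : Type*} [Fintype E]

/-- The law of independent bits, the bit at `e` being `true` with probability `P e`. -/
noncomputable abbrev bernoulliPi (P : E → ℝ) : Measure (E → Bool) :=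
  Measure.pi fun e => bernoulliBool (P e)

theorem isProbabilityMeasure_bernoulliPi {P : E → ℝ} (hP : ∀ e, P e ∈ Set.Icc (0 : ℝ) 1) :
    IsProbabilityMeasure (bernoulliPi P) := by
  have := fun e => isProbabilityMeasure_bernoulliBool (hP e)
  infer_instance

theorem integral_prod_bernoulliPi {P : E → ℝ} (hP : ∀ e, P e ∈ Set.Icc (0 : ℝ) 1)
    (f : E → Bool → ℝ) :
    ∫ ω, ∏ e, f e (ω e) ∂bernoulliPi P = ∏ e, (P e * f e true + (1 - P e) * f e false) := by
  have := fun e => isProbabilityMeasure_bernoulliBool (hP e)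
  rw [integral_fintype_prod_eq_prod]
  exact Finset.prod_congr rfl fun e _ => integral_bernoulliBool (hP e) _

theorem bernoulliPi_real_singleton {P : E → ℝ} (hP : ∀ e, P e ∈ Set.Icc (0 : ℝ) 1)
    (ω : E → Bool) :
    (bernoulliPi P).real {ω} = ∏ e, (if ω e then P e else 1 - P e) := by
  have := isProbabilityMeasure_bernoulliPi hP
  have h := integral_prod_bernoulliPi hP (fun e b => if b = ω e then (1 : ℝ) else 0)
  have h2 : (fun x : E → Bool => ∏ e, if x e = ω e then (1 : ℝ) else 0)
      = Set.indicator {ω} 1 := by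
    ext x
    by_cases hx : x = ω
    · subst hx; simp
    · obtain ⟨e, he⟩ := Function.ne_iff.1 hx
      rw [Finset.prod_eq_zero (Finset.mem_univ e) (by simp [he])]
      simp [hx]
  rw [h2, integral_indicator_one MeasurableSet.of_discrete] at h
  rw [h]
  refine Finset.prod_congr rfl fun e _ => ?_
  cases ω e <;> simp

theorem real_le_integral_of_one_le {Ω : Type*} [Finite Ω] [MeasurableSpace Ω]
    [DiscreteMeasurableSpace Ω] (μ : Measure Ω) [IsFiniteMeasure μ] {A : Set Ω} {g : Ω → ℝ}
    (hg : ∀ ω, 0 ≤ g ω) (hA : ∀ ω ∈ A, 1 ≤ g ω) : μ.real A ≤ ∫ ω, g ω ∂μ := by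
  rw [← integral_indicator_one (μ := μ) (MeasurableSet.of_discrete (s := A))]
  refine integral_mono Integrable.of_finite Integrable.of_finite fun ω => ?_
  by_cases h : ω ∈ A
  · simpa [h] using hA ω h
  · simpa [h] using hg ω

theorem measureReal_eq_sum {Ω : Type*} [Fintype Ω] [MeasurableSpace Ω]
    [DiscreteMeasurableSpace Ω] (μ : Measure Ω) [IsFiniteMeasure μ] (A : Set Ω) :
    μ.real A = ∑ ω, μ.real {ω} * A.indicator 1 ω := by
  rw [← integral_indicator_one (μ := μ) (MeasurableSet.of_discrete (s := A)),
    integral_fintype Integrable.of_finite]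
  rfl

/-- Events determined by disjoint sets of coordinates are independent. -/
theorem bernoulliPi_real_inter_of_dependsOn {P : E → ℝ} (hP : ∀ e, P e ∈ Set.Icc (0 : ℝ) 1)
    {A B : Set (E → Bool)} {I J : Finset E} (hA : DependsOn (· ∈ A) (I : Set E))
    (hB : DependsOn (· ∈ B) (J : Set E)) (hIJ : Disjoint I J) :
    (bernoulliPi P).real (A ∩ B) = (bernoulliPi P).real A * (bernoulliPi P).real B := by
  classical
  have := fun e => isProbabilityMeasure_bernoulliBool (hP e)
  have hind : iIndepFun (fun (e : E) (ω : E → Bool) => ω e) (bernoulliPi P) :=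
    iIndepFun_pi (X := fun _ b => b) fun e => measurable_id.aemeasurable
  have h := hind.indepFun_finset I J hIJ fun e => measurable_pi_apply e
  let ext (K : Finset E) (y : K → Bool) : E → Bool :=
    fun e => if he : e ∈ K then y ⟨e, he⟩ else false
  have key : ∀ (K : Finset E) (D : Set (E → Bool)), DependsOn (· ∈ D) (K : Set E) →
      D = (fun (ω : E → Bool) (e : K) => ω e) ⁻¹' {y | ext K y ∈ D} := by
    intro K D hD
    ext ω
    have := hD (x := ω) (y := ext K fun e : K => ω e) fun e he => by
      have he' : e ∈ K := he
      simp [ext, he']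
    simpa using this
  have h2 := h.measure_inter_preimage_eq_mul {y | ext I y ∈ A} {y | ext J y ∈ B}
    MeasurableSet.of_discrete MeasurableSet.of_discrete
  rw [← key I A hA, ← key J B hB] at h2
  simp only [measureReal_def, h2, ENNReal.toReal_mul]

/-- Harris' inequality for a decreasing and an increasing event. -/
theorem bernoulliPi_real_inter_le_of_isLowerSet_of_isUpperSet {P : E → ℝ}
    (hP : ∀ e, P e ∈ Set.Icc (0 : ℝ) 1) {A B : Set (E → Bool)} (hA : IsLowerSet A)
    (hB : IsUpperSet B) :
    (bernoulliPi P).real (A ∩ B) ≤ (bernoulliPi P).real A * (bernoulliPi P).real B := by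
  classical
  have := isProbabilityMeasure_bernoulliPi hP
  set μ := bernoulliPi P with hμ
  have mono : ∀ {U : Set (E → Bool)}, IsUpperSet U →
      Monotone (U.indicator (1 : (E → Bool) → ℝ)) := by
    intro U hU x y hxy
    by_cases hx : x ∈ U
    · simp [hx, hU hxy hx]
    · simp only [hx, not_false_eq_true, Set.indicator_of_notMem]
      exact Set.indicator_nonneg (by simp) _
  have h := fkg (Aᶜ.indicator (1 : (E → Bool) → ℝ)) (B.indicator 1) (fun ω => μ.real {ω})
    (fun ω => measureReal_nonneg) (Set.indicator_nonneg (by simp))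
    (Set.indicator_nonneg (by simp)) (mono hA.compl) (mono hB) (by
      intro a b
      simp only [hμ, bernoulliPi_real_singleton hP]
      rw [← Finset.prod_mul_distrib, ← Finset.prod_mul_distrib]
      refine le_of_eq (Finset.prod_congr rfl fun e _ => ?_)
      rcases le_total (a e) (b e) with h | h <;> simp [h, mul_comm])
  have h1 : ∑ ω, μ.real {ω} = 1 := by simp
  have h2 : ∀ ω, Aᶜ.indicator (1 : (E → Bool) → ℝ) ω * B.indicator 1 ω
      = (Aᶜ ∩ B).indicator 1 ω := by
    intro ω
    rw [Set.inter_indicator_one]; rfl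
  simp only [h2, h1, one_mul] at h
  rw [← measureReal_eq_sum, ← measureReal_eq_sum, ← measureReal_eq_sum,
    probReal_compl_eq_one_sub MeasurableSet.of_discrete] at h
  have h3 : μ.real (A ∩ B) + μ.real (Aᶜ ∩ B) = μ.real B := by
    rw [← measureReal_union _ MeasurableSet.of_discrete, ← Set.union_inter_distrib_right]
    · simp
    · exact (disjoint_compl_right.mono Set.inter_subset_left Set.inter_subset_left)
  linarith

end ProductBernoulli

section Janson

/-- A quadratic form evaluated at the constant vector `r ∈ [0, 1]` is at most its value at some
`0`-`1` vector, as it is affine in each coordinate. -/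
theorem exists_subset_sum_sub_half_sum_ge {ι : Type*} [DecidableEq ι] {b : ι → ι → ℝ}
    (hsymm : ∀ i j, b i j = b j i) (hdiag : ∀ i, b i i = 0) {r : ℝ} (hr : r ∈ Set.Icc (0 : ℝ) 1)
    (S : Finset ι) (a : ι → ℝ) :
    ∃ s ⊆ S, r * ∑ i ∈ S, a i - r ^ 2 / 2 * ∑ i ∈ S, ∑ j ∈ S, b i j
      ≤ ∑ i ∈ s, a i - 1 / 2 * ∑ i ∈ s, ∑ j ∈ s, b i j := by
  induction S using Finset.induction_on generalizing a with
  | empty => exact ⟨∅, subset_rfl, by simp⟩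
  | insert v S hv ih =>
    have expand : ∀ s : Finset ι, v ∉ s → ∑ i ∈ insert v s, ∑ j ∈ insert v s, b i j
        = ∑ i ∈ s, ∑ j ∈ s, b i j + 2 * ∑ j ∈ s, b v j := by
      intro s hs
      simp only [Finset.sum_insert hs, hdiag, Finset.sum_add_distrib, fun i => hsymm i v]
      ring
    obtain ⟨s₀, hs₀, h₀⟩ := ih a
    obtain ⟨s₁, hs₁, h₁⟩ := ih (fun i => a i - b v i)
    rw [expand S hv, Finset.sum_insert hv]
    rw [Finset.sum_sub_distrib, Finset.sum_sub_distrib] at h₁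
    by_cases hc : r * (a v + ∑ i ∈ S, a i)
        - r ^ 2 / 2 * (∑ i ∈ S, ∑ j ∈ S, b i j + 2 * ∑ j ∈ S, b v j)
        ≤ r * ∑ i ∈ S, a i - r ^ 2 / 2 * ∑ i ∈ S, ∑ j ∈ S, b i j
    · exact ⟨s₀, hs₀.trans (Finset.subset_insert _ _), hc.trans h₀⟩
    · refine ⟨insert v s₁, Finset.insert_subset_insert _ hs₁, ?_⟩
      have hv₁ : v ∉ s₁ := fun h => hv (hs₁ h)
      rw [expand s₁ hv₁, Finset.sum_insert hv₁]
      have hd : 0 < r * (a v - r * ∑ j ∈ S, b v j) := by linarith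
      have hd' : 0 < a v - r * ∑ j ∈ S, b v j := pos_of_mul_pos_right hd hr.1
      have := mul_le_mul_of_nonneg_right hr.2 hd'.le
      linarith

variable {E ι : Type*} [Fintype E] [DecidableEq E] [DecidableEq ι]

/-- A Janson-type inequality for decreasing events determined by sets of coordinates. -/
theorem bernoulliPi_real_forall_notMem_le {P : E → ℝ} (hP : ∀ e, P e ∈ Set.Icc (0 : ℝ) 1)
    {A : ι → Set (E → Bool)} {I : ι → Finset E} (hA : ∀ i, IsLowerSet (A i))
    (hI : ∀ i, DependsOn (· ∈ A i) (I i : Set E)) (s : Finset ι) :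
    (bernoulliPi P).real {ω | ∀ i ∈ s, ω ∉ A i} ≤
      Real.exp (-(∑ i ∈ s, (bernoulliPi P).real (A i) - 1 / 2 * ∑ i ∈ s, ∑ j ∈ s,
        if i ≠ j ∧ ¬ Disjoint (I i) (I j) then (bernoulliPi P).real (A i ∩ A j) else 0)) := by
  have := isProbabilityMeasure_bernoulliPi hP
  set μ := bernoulliPi P with hμ
  set b : ι → ι → ℝ := fun i j =>
    if i ≠ j ∧ ¬ Disjoint (I i) (I j) then μ.real (A i ∩ A j) else 0 with hb
  have hsymm : ∀ i j, b i j = b j i := by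
    intro i j
    simp only [hb, ne_comm (a := i), disjoint_comm (a := I i), Set.inter_comm (A i)]
  have hdiag : ∀ i, b i i = 0 := by simp [hb]
  change _ ≤ Real.exp (-(∑ i ∈ s, μ.real (A i) - 1 / 2 * ∑ i ∈ s, ∑ j ∈ s, b i j))
  induction s using Finset.induction_on with
  | empty => simp
  | insert v s hv ih =>
    set F : Set (E → Bool) := {ω | ∀ i ∈ s, ω ∉ A i} with hF
    set D : Set (E → Bool) := {ω | ∀ i ∈ s, Disjoint (I v) (I i) → ω ∉ A i} with hD
    have hFD : F ⊆ D := fun ω h i hi _ => h i hi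
    have hDup : IsUpperSet D := fun x y hxy hx i hi hd hy => hx i hi hd (hA i hxy hy)
    have hDdep : DependsOn (· ∈ D)
        (((s.filter fun i => Disjoint (I v) (I i)).biUnion I : Finset E) : Set E) := by
      intro x y hxy
      refine forall_congr fun i => forall_congr fun hi => forall_congr fun hd => ?_
      have := hI i (x := x) (y := y) fun e he => hxy e (by
        simp only [Finset.coe_biUnion, Set.mem_iUnion]
        exact ⟨i, by simp [hi, hd], he⟩)
      simp only [this]
    have hind : μ.real (A v ∩ D) = μ.real (A v) * μ.real D :=
      bernoulliPi_real_inter_of_dependsOn hP (hI v) hDdep (by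
        rw [Finset.disjoint_biUnion_right]
        intro i hi
        exact (Finset.mem_filter.1 hi).2)
    have hbv : ∀ j ∈ s, ¬ Disjoint (I v) (I j) → μ.real (A v ∩ A j ∩ D) ≤ b v j * μ.real D := by
      intro j hj hd
      have hne : v ≠ j := fun h => hv (h ▸ hj)
      have : b v j = μ.real (A v ∩ A j) := by simp [hb, hne, hd]
      rw [this]
      exact bernoulliPi_real_inter_le_of_isLowerSet_of_isUpperSet hP ((hA v).inter (hA j)) hDup
    have hbnn : ∀ j, 0 ≤ b v j := by
      intro j
      simp only [hb]
      split_ifs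
      exacts [measureReal_nonneg, le_rfl]
    have hcover : A v ∩ D ⊆ (A v ∩ F) ∪
        ⋃ j ∈ s.filter (fun j => ¬ Disjoint (I v) (I j)), (A v ∩ A j ∩ D) := by
      rintro ω ⟨h1, h2⟩
      by_cases h3 : ω ∈ F
      · exact Or.inl ⟨h1, h3⟩
      · right
        simp only [hF, Set.mem_ofPred_eq, not_forall, not_not] at h3
        obtain ⟨j, hj, hjA⟩ := h3
        simp only [Set.mem_iUnion]
        exact ⟨j, by simpa [hj] using fun hd => h2 j hj hd hjA, ⟨h1, hjA⟩, h2⟩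
    have hle : μ.real (A v) * μ.real D ≤ μ.real (A v ∩ F) + (∑ j ∈ s, b v j) * μ.real D := by
      rw [← hind]
      refine (measureReal_mono hcover).trans ((measureReal_union_le _ _).trans ?_)
      gcongr
      refine (measureReal_biUnion_finset_le _ _).trans ?_
      rw [Finset.sum_mul]
      refine (Finset.sum_le_sum fun j hj => hbv j (Finset.mem_filter.1 hj).1
        (Finset.mem_filter.1 hj).2).trans ?_
      exact Finset.sum_le_sum_of_subset_of_nonneg (Finset.filter_subset _ _)
        fun j _ _ => mul_nonneg (hbnn j) measureReal_nonneg
    have hset : {ω | ∀ i ∈ insert v s, ω ∉ A i} = F \ A v := by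
      ext ω
      simp [hF, and_comm]
    have hsplit : μ.real (F \ A v) = μ.real F - μ.real (A v ∩ F) := by
      have := measureReal_inter_add_sdiff (μ := μ) (s := F) (MeasurableSet.of_discrete (s := A v))
      rw [Set.inter_comm] at this
      linarith
    have hstep : μ.real (F \ A v) ≤
        μ.real F * Real.exp (-(μ.real (A v) - ∑ j ∈ s, b v j)) := by
      have hFnn : 0 ≤ μ.real F := measureReal_nonneg
      have hFDr : μ.real F ≤ μ.real D := measureReal_mono hFD
      rcases le_total (μ.real (A v) - ∑ j ∈ s, b v j) 0 with hc | hc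
      · refine (measureReal_mono Set.sdiff_subset).trans ?_
        exact le_mul_of_one_le_right hFnn (Real.one_le_exp (by linarith))
      · have := Real.add_one_le_exp (-(μ.real (A v) - ∑ j ∈ s, b v j))
        rw [hsplit]
        nlinarith
    rw [hset]
    refine hstep.trans ((mul_le_mul_of_nonneg_right ih (Real.exp_pos _).le).trans (le_of_eq ?_))
    rw [← Real.exp_add]
    congr 1
    simp only [Finset.sum_insert hv, hdiag, Finset.sum_add_distrib, fun i => hsymm i v]
    ring

theorem bernoulliPi_real_forall_notMem_le_exp_neg {P : E → ℝ}
    (hP : ∀ e, P e ∈ Set.Icc (0 : ℝ) 1) {A : ι → Set (E → Bool)} {I : ι → Finset E}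
    (hA : ∀ i, IsLowerSet (A i)) (hI : ∀ i, DependsOn (· ∈ A i) (I i : Set E)) (S : Finset ι)
    {M R : ℝ} (hR : 0 < R) (hM : M = ∑ i ∈ S, (bernoulliPi P).real (A i)) (hMR : 1 ≤ M * R)
    (hS : ∑ i ∈ S, ∑ j ∈ S, (if i ≠ j ∧ ¬ Disjoint (I i) (I j) then
      (bernoulliPi P).real (A i ∩ A j) else 0) ≤ M ^ 2 * R) :
    (bernoulliPi P).real {ω | ∀ i ∈ S, ω ∉ A i} ≤ Real.exp (-(1 / (2 * R))) := by
  have := isProbabilityMeasure_bernoulliPi hP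
  have hMpos : 0 < M := by
    by_contra! h
    nlinarith
  set b : ι → ι → ℝ := fun i j =>
    if i ≠ j ∧ ¬ Disjoint (I i) (I j) then (bernoulliPi P).real (A i ∩ A j) else 0 with hb
  have hsymm : ∀ i j, b i j = b j i := by
    intro i j
    simp only [hb, ne_comm (a := i), disjoint_comm (a := I i), Set.inter_comm (A i)]
  obtain ⟨s, hs, h⟩ := exists_subset_sum_sub_half_sum_ge hsymm (by simp [hb])
    (r := 1 / (M * R)) ⟨by positivity, by rw [div_le_one (by positivity)]; exact hMR⟩ S
    (fun i => (bernoulliPi P).real (A i))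
  refine (measureReal_mono (fun ω hω i hi => hω i (hs hi) :
    {ω | ∀ i ∈ S, ω ∉ A i} ⊆ {ω | ∀ i ∈ s, ω ∉ A i})).trans
    ((bernoulliPi_real_forall_notMem_le hP hA hI s).trans ?_)
  refine Real.exp_le_exp.2 (neg_le_neg (le_trans ?_ h))
  rw [← hM]
  have h2 : (1 / (M * R)) ^ 2 / 2 * ∑ i ∈ S, ∑ j ∈ S, b i j
      ≤ (1 / (M * R)) ^ 2 / 2 * (M ^ 2 * R) := by gcongr
  have h3 : 1 / (M * R) * M - (1 / (M * R)) ^ 2 / 2 * (M ^ 2 * R) = 1 / (2 * R) := by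
    field_simp
    norm_num
  linarith

end Janson

section DependentSets

theorem integral_prod_finset_bernoulliPi {E : Type*} [Fintype E] {P : E → ℝ}
    (hP : ∀ e, P e ∈ Set.Icc (0 : ℝ) 1) (J : Finset E) (f : E → Bool → ℝ) :
    ∫ ω, ∏ e ∈ J, f e (ω e) ∂bernoulliPi P
      = ∏ e ∈ J, (P e * f e true + (1 - P e) * f e false) := by
  classical
  have h := integral_prod_bernoulliPi hP fun e b => if e ∈ J then f e b else 1
  have h' : ∀ ω : E → Bool, ∏ e, (if e ∈ J then f e (ω e) else 1) = ∏ e ∈ J, f e (ω e) :=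
    fun ω => Fintype.prod_ite_mem _ _
  simp only [h'] at h
  rw [h, ← Fintype.prod_ite_mem J]
  refine Finset.prod_congr rfl fun e _ => ?_
  split_ifs <;> ring

theorem bernoulliPi_real_forall_eq_false {E : Type*} [Fintype E] {P : E → ℝ}
    (hP : ∀ e, P e ∈ Set.Icc (0 : ℝ) 1) (J : Finset E) :
    (bernoulliPi P).real {ω | ∀ e ∈ J, ω e = false} = ∏ e ∈ J, (1 - P e) := by
  have := isProbabilityMeasure_bernoulliPi hP
  have h := integral_prod_finset_bernoulliPi hP J (fun _ b => if b then 0 else 1)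
  have h2 : (fun ω : E → Bool => ∏ e ∈ J, if ω e then (0 : ℝ) else 1)
      = Set.indicator {ω | ∀ e ∈ J, ω e = false} 1 := by
    ext ω
    by_cases hω : ∀ e ∈ J, ω e = false
    · rw [Set.indicator_of_mem (by exact hω), Finset.prod_eq_one fun e he => by simp [hω e he]]
      rfl
    · rw [Set.indicator_of_notMem (by exact hω)]
      push Not at hω
      obtain ⟨e, he, h⟩ := hω
      exact Finset.prod_eq_zero he (by simp [h])
  rw [h2, integral_indicator_one MeasurableSet.of_discrete] at h
  simpa using h

variable {V : Type*} [DecidableEq V]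

/-- The set of potential edges inside `B`. -/
def edgesIn (B : Finset V) : Finset (Sym2 V) := B.offDiag.image fun x => s(x.1, x.2)

/-- The set of potential edges joining `v` to the other elements of `B`. -/
def starIn (B : Finset V) (v : V) : Finset (Sym2 V) := (B.erase v).image fun u => s(v, u)

/-- The edge configurations for which `B` is `t`-dependent. -/
def depEvent (t : ℕ) (B : Finset V) : Set (Sym2 V → Bool) :=
  {ω | ∀ v ∈ B, ((starIn B v).filter fun e => ω e).card ≤ t}

theorem mem_edgesIn {B : Finset V} {x y : V} : s(x, y) ∈ edgesIn B ↔ x ∈ B ∧ y ∈ B ∧ x ≠ y := by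
  simp only [edgesIn, Finset.mem_image, Finset.mem_offDiag, Prod.exists, Sym2.eq_iff]
  grind

theorem mem_starIn {B : Finset V} {v x y : V} :
    s(x, y) ∈ starIn B v ↔ x ≠ y ∧ (x = v ∧ y ∈ B ∨ y = v ∧ x ∈ B) := by
  simp only [starIn, Finset.mem_image, Finset.mem_erase, Sym2.eq_iff]
  grind

theorem card_edgesIn (B : Finset V) : (edgesIn B).card = B.card.choose 2 :=
  Sym2.card_image_offDiag B

theorem injective_mk_left {W : Type*} (v : W) : Function.Injective fun u => s(v, u) :=
  fun _ _ h => Sym2.congr_right.1 h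

theorem card_starIn {B : Finset V} {v : V} (hv : v ∈ B) : (starIn B v).card = B.card - 1 := by
  rw [starIn, Finset.card_image_of_injective _ (injective_mk_left v), Finset.card_erase_of_mem hv]

theorem starIn_subset_edgesIn {B : Finset V} {v : V} (hv : v ∈ B) : starIn B v ⊆ edgesIn B := by
  intro e
  induction e with | _ x y
  rw [mem_starIn, mem_edgesIn]
  grind

theorem starIn_mono {B C : Finset V} (h : B ⊆ C) (v : V) : starIn B v ⊆ starIn C v :=
  Finset.image_subset_image (Finset.erase_subset_erase _ h)

theorem disjoint_starIn_edgesIn {A B : Finset V} {v : V} (hv : v ∉ A) :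
    Disjoint (edgesIn A) (starIn B v) := by
  rw [Finset.disjoint_left]
  intro e
  induction e with | _ x y
  rw [mem_starIn, mem_edgesIn]
  grind

theorem edgesIn_inter (A B : Finset V) : edgesIn (A ∩ B) = edgesIn A ∩ edgesIn B := by
  ext e
  induction e with | _ x y
  simp only [Finset.mem_inter, mem_edgesIn]
  tauto

theorem disjoint_edgesIn {A B : Finset V} (h : (A ∩ B).card < 2) :
    Disjoint (edgesIn A) (edgesIn B) := by
  rw [Finset.disjoint_iff_inter_eq_empty, ← edgesIn_inter, ← Finset.card_eq_zero, card_edgesIn,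
    Nat.choose_eq_zero_of_lt h]

theorem depEvent_anti {B C : Finset V} (h : B ⊆ C) (t : ℕ) : depEvent t C ⊆ depEvent t B :=
  fun _ hω v hv =>
    (Finset.card_le_card (Finset.filter_subset_filter _ (starIn_mono h v))).trans (hω v (h hv))

theorem isLowerSet_depEvent (t : ℕ) (B : Finset V) : IsLowerSet (depEvent t B) := by
  intro x y hxy hx v hv
  refine (Finset.card_le_card ?_).trans (hx v hv)
  refine Finset.monotone_filter_right _ fun e _ he => ?_
  exact hxy e he

theorem dependsOn_depEvent (t : ℕ) (B : Finset V) :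
    DependsOn (· ∈ depEvent t B) (edgesIn B : Set (Sym2 V)) := by
  intro x y hxy
  refine forall_congr fun v => forall_congr fun hv => ?_
  rw [Finset.filter_congr fun e he => by rw [hxy e (starIn_subset_edgesIn hv he)]]

theorem isTDependent_fromEdgeSet_iff (t : ℕ) (B : Finset V) (ω : Sym2 V → Bool) :
    IsTDependent (SimpleGraph.fromEdgeSet {e | ω e = true}) t (B : Set V) ↔ ω ∈ depEvent t B := by
  refine forall_congr' fun v => forall_congr' fun hv => ?_
  rw [starIn, Finset.filter_image, Finset.card_image_of_injective _ (injective_mk_left v),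
    ← Set.ncard_coe_finset]
  have : {u | u ∈ (B : Set V) ∧ (SimpleGraph.fromEdgeSet {e | ω e = true}).Adj v u}
      = ((B.erase v).filter fun u => ω s(v, u) : Finset V) := by
    ext u
    simp only [SimpleGraph.fromEdgeSet_adj]
    simp
    tauto
  rw [← this]

variable [Fintype V]

theorem bernoulliPi_const_real_depEvent_congr {p : ℝ} (hp : p ∈ Set.Icc (0 : ℝ) 1) (t : ℕ)
    {B C : Finset V} (h : B.card = C.card) :
    (bernoulliPi fun _ : Sym2 V => p).real (depEvent t B)
      = (bernoulliPi fun _ : Sym2 V => p).real (depEvent t C) := by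
  have := isProbabilityMeasure_bernoulliPi (P := fun _ : Sym2 V => p) fun _ => hp
  obtain ⟨σ, hσ⟩ : ∃ σ : Equiv.Perm V, B.map σ.toEmbedding = C := by
    let e : {x // x ∈ B} ≃ {x // x ∈ C} := Finset.equivOfCardEq h
    refine ⟨e.extendSubtype, ?_⟩
    refine Finset.eq_of_subset_of_card_le ?_ (by simp [h])
    intro x hx
    obtain ⟨y, hy, rfl⟩ := Finset.mem_map.1 hx
    exact e.extendSubtype_mem y hy
  let S : Equiv.Perm (Sym2 V) := ⟨Sym2.map σ, Sym2.map σ.symm, fun e => by simp [Sym2.map_map],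
    fun e => by simp [Sym2.map_map]⟩
  have hstar : ∀ v, starIn C (σ v) = (starIn B v).map S.toEmbedding := by
    intro v
    rw [← hσ, starIn, starIn, Finset.map_eq_image, Finset.map_eq_image, Finset.image_image]
    change Finset.image _ ((Finset.image σ B).erase (σ v)) = _
    rw [← Finset.image_erase σ.injective, Finset.image_image]
    rfl
  rw [measureReal_eq_sum, measureReal_eq_sum]
  refine Fintype.sum_equiv (S.arrowCongr (Equiv.refl Bool)) _ _ fun ω => ?_
  congr 1
  · rw [bernoulliPi_real_singleton fun _ => hp, bernoulliPi_real_singleton fun _ => hp]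
    refine Fintype.prod_equiv S _ _ fun e => ?_
    simp
  · have : ω ∈ depEvent t B ↔
        S.arrowCongr (Equiv.refl Bool) ω ∈ depEvent t C := by
      simp only [depEvent, Set.mem_ofPred_eq, ← hσ, Finset.mem_map, forall_exists_index, and_imp,
        forall_apply_eq_imp_iff₂]
      refine forall₂_congr fun v hv => ?_
      rw [hσ]
      have := hstar v
      simp only [Equiv.coe_toEmbedding]
      rw [this, Finset.filter_map, Finset.card_map]
      simp [Function.comp_def]
    by_cases h : ω ∈ depEvent t B
    · rw [Set.indicator_of_mem h, Set.indicator_of_mem (this.1 h)]; rfl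
    · rw [Set.indicator_of_notMem h, Set.indicator_of_notMem fun h' => h (this.2 h')]

end DependentSets

section DependentSetProbabilities

variable {V : Type*} [DecidableEq V]

theorem card_filter_mem_starIn_le_two (B D : Finset V) (e : Sym2 V) :
    (D.filter fun v => e ∈ starIn B v).card ≤ 2 := by
  induction e with | _ x y
  refine (Finset.card_le_card (t := {x, y}) fun v hv => ?_).trans Finset.card_le_two
  have := (mem_starIn.1 (Finset.mem_filter.1 hv).2).2
  simp only [Finset.mem_insert, Finset.mem_singleton]
  tauto

variable [Fintype V]

theorem integral_prod_prod_starIn_le {p h : ℝ} (hp : p ∈ Set.Ioo (0 : ℝ) 1) (hh : 0 < h)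
    {B D : Finset V} (hD : D ⊆ B) :
    ∫ ω, ∏ v ∈ D, ∏ e ∈ starIn B v, (if ω e then h else 1) ∂bernoulliPi (fun _ : Sym2 V => p)
      ≤ √(1 - p + p * h ^ 2) ^ (D.card * (B.card - 1)) := by
  have hp' : p ∈ Set.Icc (0 : ℝ) 1 := ⟨hp.1.le, hp.2.le⟩
  have swap : ∀ g : Sym2 V → ℝ, ∏ v ∈ D, ∏ e ∈ starIn B v, g e
      = ∏ e, g e ^ (D.filter fun v => e ∈ starIn B v).card := by
    intro g
    simp_rw [← Fintype.prod_ite_mem (starIn B _), Finset.prod_comm (s := D), ← Finset.prod_const,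
      Finset.prod_filter]
  have hr : √(1 - p + p * h ^ 2) ^ (D.card * (B.card - 1))
      = ∏ v ∈ D, ∏ e ∈ starIn B v, √(1 - p + p * h ^ 2) := by
    rw [Finset.prod_congr rfl fun v hv => by
      rw [Finset.prod_const, card_starIn (hD hv)], Finset.prod_const, ← pow_mul, mul_comm D.card]
  rw [hr]
  simp_rw [swap]
  rw [integral_prod_bernoulliPi (fun _ => hp') fun e b =>
    (if b then h else 1) ^ (D.filter fun v => e ∈ starIn B v).card]
  have h1 : 0 < 1 - p := by linarith [hp.2]
  have h0 : 0 < p := hp.1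
  refine Finset.prod_le_prod (fun e _ => by simp; positivity) fun e _ => ?_
  have := card_filter_mem_starIn_le_two B D e
  generalize (D.filter fun v => e ∈ starIn B v).card = c at this ⊢
  interval_cases c
  · simp
  · simp only [pow_one, if_true, Bool.false_eq_true, if_false, mul_one]
    refine Real.le_sqrt_of_sq_le ?_
    nlinarith [mul_nonneg (mul_nonneg h0.le h1.le) (sq_nonneg (h - 1))]
  · rw [Real.sq_sqrt (by positivity)]
    simp
    linarith

/-- An upper bound for the probability that two sets are both `t`-dependent, obtained by
considering the degrees of the vertices that are in the second set only. -/
theorem real_depEvent_inter_le_mul_exp {p : ℝ} (hp : p ∈ Set.Ioo (0 : ℝ) 1) (t : ℕ)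
    (A B : Finset V) {s : ℝ} (hs : 0 ≤ s) :
    (bernoulliPi fun _ : Sym2 V => p).real (depEvent t A ∩ depEvent t B) ≤
      (bernoulliPi fun _ : Sym2 V => p).real (depEvent t A) *
        Real.exp ((B \ A).card / 2 *
          (s * t + (B.card - 1) * Real.log (1 - p + p * Real.exp (-s)))) := by
  have hp' : p ∈ Set.Icc (0 : ℝ) 1 := ⟨hp.1.le, hp.2.le⟩
  have h1 : 0 < 1 - p := by linarith [hp.2]
  have h0 : 0 < p := hp.1
  have := isProbabilityMeasure_bernoulliPi (P := fun _ : Sym2 V => p) fun _ => hp'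
  set μ := bernoulliPi fun _ : Sym2 V => p with hμ
  set D := B \ A with hD
  have hDB : D ⊆ B := Finset.sdiff_subset
  rcases D.eq_empty_or_nonempty with hDe | hDn
  · simpa [hDe] using measureReal_mono Set.inter_subset_left
  set Q : Set (Sym2 V → Bool) :=
    {ω | ∑ v ∈ D, ((starIn B v).filter fun e => ω e).card ≤ D.card * t} with hQ
  have hBQ : depEvent t B ⊆ Q := by
    intro ω hω
    rw [hQ, Set.mem_ofPred_eq, ← smul_eq_mul]
    exact Finset.sum_le_card_nsmul _ _ _ fun v hv => hω v (hDB hv)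
  have hQdep : DependsOn (· ∈ Q) ((D.biUnion (starIn B) : Finset (Sym2 V)) : Set (Sym2 V)) := by
    intro x y hxy
    simp only [hQ, Set.mem_ofPred_eq]
    rw [Finset.sum_congr rfl fun v hv => by
      rw [Finset.filter_congr fun e he => by rw [hxy e (by simpa using ⟨v, hv, he⟩)]]]
  have hdisj : Disjoint (edgesIn A) (D.biUnion (starIn B)) := by
    rw [Finset.disjoint_biUnion_right]
    exact fun v hv => disjoint_starIn_edgesIn (Finset.mem_sdiff.1 hv).2
  refine (measureReal_mono (Set.inter_subset_inter_right _ hBQ)).trans ?_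
  rw [bernoulliPi_real_inter_of_dependsOn (fun _ => hp') (dependsOn_depEvent t A) hQdep hdisj]
  refine mul_le_mul_of_nonneg_left ?_ measureReal_nonneg
  have hB1 : 1 ≤ B.card := (Finset.card_pos.2 (hDn.mono hDB))
  have hexp : ∀ ω : Sym2 V → Bool,
      ∏ v ∈ D, ∏ e ∈ starIn B v, (if ω e then Real.exp (-(s / 2)) else 1)
        = Real.exp (-(s / 2) * (∑ v ∈ D, ((starIn B v).filter fun e => ω e).card : ℕ)) := by
    intro ω
    push_cast
    rw [Finset.mul_sum, Real.exp_sum]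
    refine Finset.prod_congr rfl fun v _ => ?_
    rw [← Finset.prod_filter, Finset.prod_const, mul_comm, Real.exp_nat_mul]
  refine (real_le_integral_of_one_le μ (g := fun ω => Real.exp (s / 2 * (D.card * t)) *
    ∏ v ∈ D, ∏ e ∈ starIn B v, (if ω e then Real.exp (-(s / 2)) else 1))
    (fun ω => by rw [hexp]; positivity) (fun ω hω => ?_)).trans ?_
  · rw [hexp, ← Real.exp_add]
    refine Real.one_le_exp ?_
    have : ((∑ v ∈ D, ((starIn B v).filter fun e => ω e).card : ℕ) : ℝ) ≤ D.card * t := by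
      exact_mod_cast hω
    nlinarith
  · rw [integral_const_mul]
    refine (mul_le_mul_of_nonneg_left (integral_prod_prod_starIn_le hp (Real.exp_pos _) hDB)
      (Real.exp_pos _).le).trans (le_of_eq ?_)
    have hm : 0 < 1 - p + p * Real.exp (-s) := by positivity
    have hh : Real.exp (-(s / 2)) ^ 2 = Real.exp (-s) := by
      rw [← Real.exp_nat_mul]
      congr 1
      push_cast
      ring
    rw [hh]
    have hsq : √(1 - p + p * Real.exp (-s))
        = Real.exp (Real.log (1 - p + p * Real.exp (-s)) / 2) := by
      rw [Real.sqrt_eq_rpow, Real.rpow_def_of_pos hm]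
      ring_nf
    rw [hsq, ← Real.exp_nat_mul, ← Real.exp_add]
    congr 1
    push_cast [hB1]
    ring

theorem real_depEvent_inter_le_mul_inv_pow {p : ℝ} (hp : p ∈ Set.Ioo (0 : ℝ) 1) (t : ℕ)
    (A B : Finset V) :
    (bernoulliPi fun _ : Sym2 V => p).real (depEvent t A ∩ depEvent t B) ≤
      (bernoulliPi fun _ : Sym2 V => p).real (depEvent t A) *
        (bernoulliPi fun _ : Sym2 V => p).real (depEvent t B) *
          (1 - p)⁻¹ ^ ((A ∩ B).card.choose 2) := by
  have hp' : p ∈ Set.Icc (0 : ℝ) 1 := ⟨hp.1.le, hp.2.le⟩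
  have h1 : 0 < 1 - p := by linarith [hp.2]
  have := isProbabilityMeasure_bernoulliPi (P := fun _ : Sym2 V => p) fun _ => hp'
  set μ := bernoulliPi fun _ : Sym2 V => p with hμ
  set I := edgesIn (A ∩ B) with hI
  set B' : Set (Sym2 V → Bool) := {ω | (fun e => if e ∈ I then false else ω e) ∈ depEvent t B}
    with hB'
  have hsub : depEvent t B ⊆ B' := fun ω hω => isLowerSet_depEvent t B (fun e => by
    by_cases he : e ∈ I <;> simp [he]) hω
  have hdep : DependsOn (· ∈ B') ((edgesIn B \ I : Finset (Sym2 V)) : Set (Sym2 V)) := by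
    intro x y hxy
    refine dependsOn_depEvent t B fun e he => ?_
    by_cases he' : e ∈ I
    · simp [he']
    · simpa [he'] using hxy e (by simpa [he'] using he)
  have hoff : DependsOn (· ∈ {ω : Sym2 V → Bool | ∀ e ∈ I, ω e = false})
      (I : Set (Sym2 V)) := by
    intro x y hxy
    refine forall_congr fun e => forall_congr fun he => ?_
    rw [hxy e he]
  have hlow : μ.real B' * (1 - p) ^ ((A ∩ B).card.choose 2) ≤ μ.real (depEvent t B) := by
    have h := bernoulliPi_real_inter_of_dependsOn (fun _ => hp') hdep hoff
      Finset.sdiff_disjoint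
    rw [bernoulliPi_real_forall_eq_false (fun _ => hp'), Finset.prod_const, hI, card_edgesIn] at h
    rw [← h]
    refine measureReal_mono ?_
    rintro ω ⟨h1, h2⟩
    have : (fun e => if e ∈ I then false else ω e) = ω := by
      ext e
      by_cases he : e ∈ I
      · simp [he, h2 e he]
      · simp [he]
    rwa [hB', Set.mem_ofPred_eq, this] at h1
  have hdisj : Disjoint (edgesIn A) (edgesIn B \ I) := by
    rw [hI, edgesIn_inter, Finset.disjoint_left]
    intro e
    simp only [Finset.mem_sdiff, Finset.mem_inter]
    tauto
  refine (measureReal_mono (Set.inter_subset_inter_right _ hsub)).trans ?_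
  rw [bernoulliPi_real_inter_of_dependsOn (fun _ => hp') (dependsOn_depEvent t A) hdep hdisj,
    mul_assoc]
  refine mul_le_mul_of_nonneg_left ?_ measureReal_nonneg
  rw [inv_pow, ← div_eq_mul_inv, le_div_iff₀ (by positivity)]
  exact hlow

theorem bernoulliPi_real_ge_mul_exp {E : Type*} [Fintype E] [DecidableEq E] {p r : ℝ}
    (hp : p ∈ Set.Ioo (0 : ℝ) 1) (hr : r ∈ Set.Ioc 0 p) (J : Finset E) {θ : ℝ}
    {A : Set (E → Bool)} (hA : ∀ ω ∈ A, θ * J.card ≤ (J.filter fun e => ω e).card) :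
    (bernoulliPi fun e => if e ∈ J then r else p).real A *
        Real.exp (J.card * (θ * Real.log (p / r) + (1 - θ) * Real.log ((1 - p) / (1 - r))))
      ≤ (bernoulliPi fun _ : E => p).real A := by
  obtain ⟨h0, h1⟩ := hp
  obtain ⟨hr0, hrp⟩ := hr
  have hp' : ∀ e : E, p ∈ Set.Icc (0 : ℝ) 1 := fun _ => ⟨h0.le, h1.le⟩
  have hP : ∀ e : E, (if e ∈ J then r else p) ∈ Set.Icc (0 : ℝ) 1 := by
    intro e
    split_ifs
    exacts [⟨hr0.le, by linarith⟩, hp' e]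
  have := isProbabilityMeasure_bernoulliPi hp'
  have := isProbabilityMeasure_bernoulliPi hP
  rw [measureReal_eq_sum, measureReal_eq_sum, Finset.sum_mul]
  refine Finset.sum_le_sum fun ω _ => ?_
  by_cases hω : ω ∈ A
  swap
  · simp [hω]
  rw [Set.indicator_of_mem hω, Pi.one_apply, mul_one, mul_one, bernoulliPi_real_singleton hP,
    bernoulliPi_real_singleton hp']
  have hpr : 0 < p / r := by positivity
  have hqr : 0 < (1 - p) / (1 - r) := div_pos (by linarith) (by linarith)
  have hlog : Real.log ((1 - p) / (1 - r)) ≤ Real.log (p / r) := by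
    refine Real.log_le_log hqr (le_trans (b := 1) ?_ ?_)
    · rw [div_le_one (by linarith)]; linarith
    · rw [le_div_iff₀ hr0]; linarith
  have hsplit : ∏ e, (if ω e then p else 1 - p)
      = (∏ e, (if ω e then (if e ∈ J then r else p) else 1 - (if e ∈ J then r else p))) *
        ∏ e ∈ J, (if ω e then p / r else (1 - p) / (1 - r)) := by
    rw [← Fintype.prod_ite_mem J, ← Finset.prod_mul_distrib]
    refine Finset.prod_congr rfl fun e _ => ?_
    have : 1 - r ≠ 0 := by linarith
    split_ifs <;> field_simp
  rw [hsplit]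
  refine mul_le_mul_of_nonneg_left ?_ (Finset.prod_nonneg fun e _ => ?_)
  · rw [Finset.prod_ite, Finset.prod_const, Finset.prod_const]
    have hc := Finset.card_filter_add_card_filter_not (s := J) fun e => ω e
    set a := (J.filter fun e => ω e).card
    set b := (J.filter fun e => ¬ ω e).card
    have hcr : (a : ℝ) + b = J.card := by exact_mod_cast hc
    rw [← Real.exp_log hpr, ← Real.exp_log hqr, ← Real.exp_nat_mul, ← Real.exp_nat_mul,
      ← Real.exp_add, Real.exp_log hpr, Real.exp_log hqr]
    refine Real.exp_le_exp.2 ?_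
    have := mul_le_mul_of_nonneg_right (hA ω hω) (sub_nonneg.2 hlog)
    rw [← hcr] at this ⊢
    linarith
  · split_ifs <;> linarith

theorem bernoulliPi_real_setOf_le_exp {E : Type*} [Fintype E] {P : E → ℝ}
    (hP : ∀ e, P e ∈ Set.Icc (0 : ℝ) 1) {J : Finset E} {r : ℝ} (hr : ∀ e ∈ J, P e = r) (s a : ℝ) :
    (bernoulliPi P).real {ω | s * a ≤ s * (J.filter fun e => ω e).card} ≤
      Real.exp (J.card * (r * (Real.exp s - 1)) - s * a) := by
  have := isProbabilityMeasure_bernoulliPi hP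
  have hexp : ∀ ω : E → Bool, ∏ e ∈ J, (if ω e then Real.exp s else 1)
      = Real.exp (s * (J.filter fun e => ω e).card) := by
    intro ω
    rw [← Finset.prod_filter, Finset.prod_const, mul_comm, Real.exp_nat_mul]
  refine (real_le_integral_of_one_le _ (g := fun ω => Real.exp (-(s * a)) *
    ∏ e ∈ J, (if ω e then Real.exp s else 1)) (fun ω => by rw [hexp]; positivity)
    (fun ω hω => ?_)).trans ?_
  · rw [hexp, ← Real.exp_add]
    have : s * a ≤ s * (J.filter fun e => ω e).card := hω
    exact Real.one_le_exp (by linarith)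
  · rw [integral_const_mul, integral_prod_finset_bernoulliPi hP J
      (fun _ b => if b then Real.exp s else 1), sub_eq_add_neg, add_comm, Real.exp_add]
    refine mul_le_mul_of_nonneg_left ?_ (Real.exp_pos _).le
    rw [Real.exp_nat_mul, ← Finset.prod_const]
    refine Finset.prod_le_prod (fun e _ => ?_) fun e he => ?_
    · have := hP e
      have h2 := Real.exp_pos s
      simp only [if_true, Bool.false_eq_true, if_false]
      nlinarith [this.1, this.2]
    · rw [hr e he]
      refine le_trans (le_of_eq ?_) (Real.add_one_le_exp _)
      simp
      ring

/-- A lower bound for the probability that `B` is `t`-dependent, by comparison with a random graph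
of smaller density `r`. -/
theorem le_real_depEvent {p r : ℝ} (hp : p ∈ Set.Ioo (0 : ℝ) 1) (hr : r ∈ Set.Ioc 0 p) (t : ℕ)
    (B : Finset V) {s u θ : ℝ} (hs : 0 ≤ s) (hu : 0 ≤ u) :
    (1 - B.card * Real.exp (B.card * (r * (Real.exp s - 1)) - s * t) -
        Real.exp (B.card.choose 2 * (r * (Real.exp (-u) - 1) + u * θ))) *
      Real.exp (B.card.choose 2 *
        (θ * Real.log (p / r) + (1 - θ) * Real.log ((1 - p) / (1 - r))))
      ≤ (bernoulliPi fun _ : Sym2 V => p).real (depEvent t B) := by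
  have hp' : p ∈ Set.Icc (0 : ℝ) 1 := ⟨hp.1.le, hp.2.le⟩
  have hr' : r ∈ Set.Icc (0 : ℝ) 1 := ⟨hr.1.le, hr.2.trans hp.2.le⟩
  have hP : ∀ e, (if e ∈ edgesIn B then r else p) ∈ Set.Icc (0 : ℝ) 1 := by
    intro e
    split_ifs
    exacts [hr', hp']
  have := isProbabilityMeasure_bernoulliPi (P := fun _ : Sym2 V => p) fun _ => hp'
  have := isProbabilityMeasure_bernoulliPi hP
  set ν := bernoulliPi fun e => if e ∈ edgesIn B then r else p with hν
  set A : Set (Sym2 V → Bool) := depEvent t B ∩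
    {ω | θ * (edgesIn B).card ≤ ((edgesIn B).filter fun e => ω e).card} with hA
  have h := bernoulliPi_real_ge_mul_exp hp hr (edgesIn B) (θ := θ) (A := A) fun ω hω => hω.2
  rw [card_edgesIn] at h
  refine le_trans ?_ (h.trans (measureReal_mono Set.inter_subset_left))
  refine mul_le_mul_of_nonneg_right ?_ (Real.exp_pos _).le
  have hcover : Aᶜ ⊆ (⋃ v ∈ B, {ω : Sym2 V → Bool |
      s * t ≤ s * ((starIn B v).filter fun e => ω e).card}) ∪
      {ω | -u * (θ * (edgesIn B).card) ≤ -u * ((edgesIn B).filter fun e => ω e).card} := by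
    intro ω hω
    by_contra hcon
    simp only [Set.mem_union, Set.mem_iUnion, not_or, not_exists, Set.mem_ofPred_eq, not_le]
      at hcon
    refine hω ⟨fun v hv => ?_, ?_⟩
    · have := hcon.1 v hv
      by_contra! h
      have : (t : ℝ) ≤ ((starIn B v).filter fun e => ω e).card := by exact_mod_cast h.le
      nlinarith [hcon.1 v hv]
    · rw [Set.mem_ofPred_eq]
      by_contra! h
      nlinarith [hcon.2]
  have hle : ν.real Aᶜ ≤ B.card * Real.exp (B.card * (r * (Real.exp s - 1)) - s * t) +
      Real.exp (B.card.choose 2 * (r * (Real.exp (-u) - 1) + u * θ)) := by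
    refine (measureReal_mono hcover).trans ((measureReal_union_le _ _).trans (add_le_add ?_ ?_))
    · refine (measureReal_biUnion_finset_le _ _).trans ?_
      rw [← nsmul_eq_mul]
      refine Finset.sum_le_card_nsmul _ _ _ fun v hv => ?_
      refine (bernoulliPi_real_setOf_le_exp hP (r := r) (fun e he => by
        rw [if_pos (starIn_subset_edgesIn hv he)]) s t).trans (Real.exp_le_exp.2 ?_)
      rw [card_starIn hv]
      have : ((B.card - 1 : ℕ) : ℝ) ≤ B.card := by exact_mod_cast Nat.sub_le _ _
      have h2 : 0 ≤ r * (Real.exp s - 1) :=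
        mul_nonneg hr.1.le (by linarith [Real.one_le_exp hs])
      nlinarith
    · refine (bernoulliPi_real_setOf_le_exp hP (r := r) (fun e he => by rw [if_pos he])
        (-u) _).trans (Real.exp_le_exp.2 (le_of_eq ?_))
      rw [card_edgesIn]
      ring
  rw [probReal_compl_eq_one_sub MeasurableSet.of_discrete] at hle
  linarith

end DependentSetProbabilities

section Colouring

variable {V : Type*}

theorem isTDependent_singleton (G : SimpleGraph V) (t : ℕ) (v : V) : IsTDependent G t {v} := by
  rintro u rfl
  have : {w | w ∈ ({u} : Set V) ∧ G.Adj u w} = ∅ := by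
    ext w
    simp only [Set.mem_singleton_iff, Set.mem_ofPred_eq, Set.mem_empty_iff_false, iff_false,
      not_and]
    rintro rfl
    exact G.irrefl
  rw [this, Set.ncard_empty]
  exact Nat.zero_le t

theorem card_le_improperChromaticNumber_mul [Fintype V] {G : SimpleGraph V} {t K : ℕ}
    (hK : ∀ S : Finset V, IsTDependent G t (S : Set V) → S.card ≤ K) :
    Fintype.card V ≤ improperChromaticNumber G t * K := by
  classical
  have hne : {k | ∃ c : V → Fin k, ∀ i : Fin k, IsTDependent G t {v | c v = i}}.Nonempty := by
    refine ⟨Fintype.card V, Fintype.equivFin V, fun i => ?_⟩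
    have : {v | Fintype.equivFin V v = i} = {(Fintype.equivFin V).symm i} := by
      ext v
      simp [Equiv.eq_symm_apply]
    rw [this]
    exact isTDependent_singleton _ _ _
  obtain ⟨c, hc⟩ := Nat.sInf_mem hne
  rw [← Finset.card_univ, Finset.card_eq_sum_card_fiberwise (f := c) (t := Finset.univ)
    fun _ _ => Finset.mem_coe.2 (Finset.mem_univ _)]
  refine (Finset.sum_le_card_nsmul _ _ K fun i _ => hK _ ?_).trans ?_
  · simpa using hc i
  · simp only [Finset.card_univ, Fintype.card_fin, smul_eq_mul]
    exact le_rfl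

/-- The set `U` can be partitioned into `N` sets that are `t`-dependent. -/
def ImproperColorableOn (G : SimpleGraph V) (t : ℕ) (U : Finset V) (N : ℕ) : Prop :=
  ∃ c : V → ℕ, (∀ v ∈ U, c v < N) ∧ ∀ i, IsTDependent G t {v | v ∈ U ∧ c v = i}

theorem ImproperColorableOn.mono {G : SimpleGraph V} {t : ℕ} {U : Finset V} {N M : ℕ}
    (h : ImproperColorableOn G t U N) (hNM : N ≤ M) : ImproperColorableOn G t U M := by
  obtain ⟨c, h1, h2⟩ := h
  exact ⟨c, fun v hv => (h1 v hv).trans_le hNM, h2⟩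

theorem ImproperColorableOn.succ_of_sdiff [DecidableEq V] {G : SimpleGraph V} {t : ℕ}
    {U S : Finset V} {N : ℕ} (h : ImproperColorableOn G t (U \ S) N) (hSU : S ⊆ U)
    (hS : IsTDependent G t (S : Set V)) : ImproperColorableOn G t U (N + 1) := by
  obtain ⟨c, h1, h2⟩ := h
  refine ⟨fun v => if v ∈ S then N else c v, fun v hv => ?_, fun i => ?_⟩
  · by_cases hvS : v ∈ S
    · simp [hvS]
    · simpa [hvS] using (h1 v (by simp [hv, hvS])).trans (Nat.lt_succ_self N)
  · rcases eq_or_ne i N with rfl | hi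
    · convert! hS using 1
      ext v
      by_cases hvS : v ∈ S
      · simp [hvS, hSU hvS]
      · simpa [hvS] using fun hv => (h1 v (by simp [hv, hvS])).ne
    · convert! h2 i using 1
      ext v
      by_cases hvS : v ∈ S
      · simp [hvS, hi.symm]
      · simp [hvS]

theorem improperColorableOn_card [DecidableEq V] (G : SimpleGraph V) (t : ℕ) (U : Finset V) :
    ImproperColorableOn G t U U.card := by
  induction U using Finset.induction_on with
  | empty => exact ⟨fun _ => 0, by simp, by simp [IsTDependent]⟩
  | insert v U hv ih =>
    rw [Finset.card_insert_of_notMem hv]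
    refine ImproperColorableOn.succ_of_sdiff (S := {v}) ?_ (by simp) (by
      simpa using isTDependent_singleton G t v)
    rwa [Finset.sdiff_singleton_eq_erase, Finset.erase_insert hv]

theorem improperColorableOn_of_forall_exists [DecidableEq V] {G : SimpleGraph V} {t k m : ℕ}
    (hk : 0 < k) (h : ∀ U : Finset V, U.card = m → ∃ S ⊆ U, S.card = k ∧
      IsTDependent G t (S : Set V)) (U : Finset V) :
    ImproperColorableOn G t U (U.card / k + m) := by
  induction U using Finset.strongInduction with
  | H U ih =>
    rcases lt_or_ge U.card m with hU | hU
    · exact (improperColorableOn_card G t U).mono (hU.le.trans (Nat.le_add_left _ _))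
    · obtain ⟨W, hWU, hW⟩ := Finset.exists_subset_card_eq hU
      obtain ⟨S, hSW, hSk, hS⟩ := h W hW
      have hSU := hSW.trans hWU
      have hlt : U \ S ⊂ U := Finset.sdiff_ssubset hSU (Finset.card_pos.1 (by omega))
      refine ((ih _ hlt).succ_of_sdiff hSU hS).mono (le_of_eq ?_)
      have hkU : k ≤ U.card := hSk ▸ Finset.card_le_card hSU
      rw [Finset.card_sdiff_of_subset hSU, hSk, Nat.div_eq_sub_div hk hkU]
      omega

theorem improperChromaticNumber_le_of_forall_exists [Fintype V] {G : SimpleGraph V} {t k m : ℕ}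
    (hk : 0 < k) (h : ∀ U : Finset V, U.card = m → ∃ S ⊆ U, S.card = k ∧
      IsTDependent G t (S : Set V)) :
    improperChromaticNumber G t ≤ Fintype.card V / k + m := by
  classical
  obtain ⟨c, h1, h2⟩ := improperColorableOn_of_forall_exists hk h Finset.univ
  refine Nat.sInf_le ⟨fun v => ⟨c v, h1 v (Finset.mem_univ v)⟩, fun i => ?_⟩
  simpa [Fin.ext_iff] using h2 i

end Colouring

section Moments

variable {V : Type*} [DecidableEq V] [Fintype V]

theorem real_exists_depEvent_le {p : ℝ} (hp : p ∈ Set.Ioo (0 : ℝ) 1) (t k : ℕ) {s : ℝ}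
    (hs : 0 ≤ s) (hV : 0 < Fintype.card V) :
    (bernoulliPi fun _ : Sym2 V => p).real {ω | ∃ S : Finset V, S.card = k ∧ ω ∈ depEvent t S} ≤
      Real.exp (k * (Real.log (Fintype.card V) +
        (s * t + (k - 1) * Real.log (1 - p + p * Real.exp (-s))) / 2)) := by
  have hp' : p ∈ Set.Icc (0 : ℝ) 1 := ⟨hp.1.le, hp.2.le⟩
  have := isProbabilityMeasure_bernoulliPi (P := fun _ : Sym2 V => p) fun _ => hp'
  have hset : {ω : Sym2 V → Bool | ∃ S : Finset V, S.card = k ∧ ω ∈ depEvent t S}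
      = ⋃ S ∈ Finset.univ.powersetCard k, depEvent t S := by
    ext ω
    simp [Finset.mem_powersetCard]
  rw [hset]
  refine (measureReal_biUnion_finset_le _ _).trans ((Finset.sum_le_card_nsmul _ _
    (Real.exp (k / 2 * (s * t + (k - 1) * Real.log (1 - p + p * Real.exp (-s))))) ?_).trans ?_)
  · intro S hS
    have h := real_depEvent_inter_le_mul_exp hp t ∅ S hs
    have h0 : depEvent t (∅ : Finset V) = Set.univ := by
      ext; simp [depEvent]
    rwa [h0, Set.univ_inter, probReal_univ, one_mul, Finset.sdiff_empty,
      (Finset.mem_powersetCard.1 hS).2] at h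
  · rw [Finset.card_powersetCard, Finset.card_univ, nsmul_eq_mul, mul_add (k : ℝ), Real.exp_add,
      ← mul_div_right_comm, mul_div_assoc]
    refine mul_le_mul_of_nonneg_right ?_ (Real.exp_pos _).le
    rw [Real.exp_nat_mul, Real.exp_log (by exact_mod_cast hV)]
    exact_mod_cast Nat.choose_le_pow _ _

theorem choose_mul_choose_le_pow_mul {k l m : ℕ} (hl : l ≤ k) (hk : 2 * k ≤ m) (hk0 : 0 < k) :
    (k.choose l * (m - k).choose (k - l) : ℝ) ≤ (2 * k ^ 3 / m) ^ l * m.choose k := by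
  have hm : (0 : ℝ) < m := by exact_mod_cast (by omega : 0 < m)
  have hkR : (0 : ℝ) < k := by exact_mod_cast hk0
  have h1 : (m.choose k * k.choose l : ℝ) = m.choose l * (m - l).choose (k - l) := by
    exact_mod_cast Nat.choose_mul hl
  have h2 : ((m - k).choose (k - l) : ℝ) ≤ (m - l).choose (k - l) := by
    exact_mod_cast Nat.choose_le_choose _ (by omega)
  have h3 : (k.choose l : ℝ) ≤ k ^ l := by exact_mod_cast Nat.choose_le_pow _ _
  have h4 : ((m : ℝ) / (2 * k)) ^ l ≤ m.choose l := by
    refine le_trans ?_ (Nat.pow_le_choose l m)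
    rw [div_pow, mul_pow, div_le_div_iff₀ (by positivity) (by positivity)]
    have h5 : (m : ℝ) / 2 ≤ (m + 1 - l : ℕ) := by
      rw [div_le_iff₀ two_pos]
      exact_mod_cast (by omega : m ≤ (m + 1 - l) * 2)
    have h6 : (l.factorial : ℝ) ≤ k ^ l := by
      exact_mod_cast (Nat.factorial_le_pow l).trans (Nat.pow_le_pow_left hl l)
    calc (m : ℝ) ^ l * l.factorial = (m / 2) ^ l * 2 ^ l * l.factorial := by
          rw [← mul_pow]; ring_nf
      _ ≤ (m + 1 - l : ℕ) ^ l * 2 ^ l * k ^ l := by gcongr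
      _ = _ := by ring
  have h7 : (k.choose l * (m - l).choose (k - l) : ℝ) * ((m : ℝ) / (2 * k)) ^ l
      ≤ k ^ l * k ^ l * m.choose k := by
    calc (k.choose l * (m - l).choose (k - l) : ℝ) * ((m : ℝ) / (2 * k)) ^ l
        ≤ k.choose l * (m - l).choose (k - l) * m.choose l := by gcongr
      _ = k.choose l * k.choose l * m.choose k := by
        rw [mul_assoc, mul_comm _ (m.choose l : ℝ), ← h1]
        ring
      _ ≤ _ := by gcongr
  calc (k.choose l * (m - k).choose (k - l) : ℝ) ≤ k.choose l * (m - l).choose (k - l) := by gcongr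
    _ ≤ k ^ l * k ^ l * m.choose k / ((m : ℝ) / (2 * k)) ^ l := by
      rw [le_div_iff₀ (by positivity)]; exact h7
    _ = _ := by
      have h8 : (2 * k ^ 3 / m : ℝ) ^ l * ((m : ℝ) / (2 * k)) ^ l = k ^ l * k ^ l := by
        rw [← mul_pow, ← mul_pow]
        congr 1
        field_simp
      rw [← h8, div_eq_iff (by positivity)]
      ring

theorem card_filter_card_inter_eq_le {W : Type*} [DecidableEq W] {A U : Finset W} (hAU : A ⊆ U)
    (k l : ℕ) :
    ((U.powersetCard k).filter fun B => (A ∩ B).card = l).card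
      ≤ A.card.choose l * (U.card - A.card).choose (k - l) := by
  rw [← Finset.card_sdiff_of_subset hAU, ← Finset.card_powersetCard, ← Finset.card_powersetCard,
    ← Finset.card_product]
  refine Finset.card_le_card_of_injOn (fun B => (A ∩ B, B \ A)) (fun B hB => ?_) ?_
  · simp only [Finset.coe_filter, Set.mem_ofPred_eq, Finset.mem_powersetCard] at hB
    simp only [Finset.coe_product, Set.mem_prod, Finset.mem_coe, Finset.mem_powersetCard]
    refine ⟨⟨Finset.inter_subset_left, hB.2⟩, Finset.sdiff_subset_sdiff hB.1.1 subset_rfl, ?_⟩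
    rw [Finset.card_sdiff, hB.2, hB.1.2]
  · intro B _ C _ h
    simp only [Prod.mk.injEq] at h
    rw [← Finset.sdiff_union_inter B A, ← Finset.sdiff_union_inter C A, Finset.inter_comm B,
      Finset.inter_comm C, h.1, h.2]

/-- A second moment bound combined with Janson's inequality: it is very unlikely that `U` contains
no `t`-dependent set of size `k`. -/
theorem real_forall_notMem_depEvent_le {p : ℝ} (hp : p ∈ Set.Ioo (0 : ℝ) 1) (t : ℕ) {k : ℕ}
    {U : Finset V} (hk : 2 ≤ k) (hU : 2 * k ≤ U.card) {s R q₀ : ℝ} (hs : 0 ≤ s) (hq₀ : 0 < q₀)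
    (hπ : ∀ B : Finset V, B.card = k → q₀ ≤ (bernoulliPi fun _ : Sym2 V => p).real (depEvent t B))
    (hR : ∀ l ∈ Finset.Icc 2 k, (2 * k ^ 3 / U.card : ℝ) ^ l *
      min ((1 - p)⁻¹ ^ l.choose 2) (Real.exp ((k - l) / 2 *
          (s * t + (k - 1) * Real.log (1 - p + p * Real.exp (-s)))) / q₀) ≤ R / k) :
    (bernoulliPi fun _ : Sym2 V => p).real {ω | ∀ S ∈ U.powersetCard k, ω ∉ depEvent t S}
      ≤ Real.exp (-(1 / (2 * R))) := by
  have hp' : p ∈ Set.Icc (0 : ℝ) 1 := ⟨hp.1.le, hp.2.le⟩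
  have h1p : 0 < 1 - p := by linarith [hp.2]
  have := isProbabilityMeasure_bernoulliPi (P := fun _ : Sym2 V => p) fun _ => hp'
  set μ := bernoulliPi fun _ : Sym2 V => p with hμ
  have hkR : (0 : ℝ) < k := by exact_mod_cast (by omega : 0 < k)
  have hmR : (0 : ℝ) < U.card := by exact_mod_cast (by omega : 0 < U.card)
  obtain ⟨B₀, hB₀U, hB₀⟩ := Finset.exists_subset_card_eq (by omega : k ≤ U.card)
  set π := μ.real (depEvent t B₀) with hπdef
  have hπeq : ∀ B : Finset V, B.card = k → μ.real (depEvent t B) = π := fun B hB =>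
    bernoulliPi_const_real_depEvent_congr hp' t (hB.trans hB₀.symm)
  have hπ₀ : q₀ ≤ π := hπ B₀ hB₀
  have hπpos : 0 < π := hq₀.trans_le hπ₀
  set ρ : ℕ → ℝ := fun l => min ((1 - p)⁻¹ ^ l.choose 2) (Real.exp ((k - l) / 2 *
          (s * t + (k - 1) * Real.log (1 - p + p * Real.exp (-s)))) / q₀) with hρ
  have hρpos : ∀ l, 0 < ρ l := fun l => lt_min (by positivity) (by positivity)
  have hpair : ∀ A B : Finset V, A.card = k → B.card = k →
      μ.real (depEvent t A ∩ depEvent t B) ≤ π ^ 2 * ρ (A ∩ B).card := by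
    intro A B hA hB
    have hBA : ((B \ A).card : ℝ) = k - (A ∩ B).card := by
      rw [Finset.card_sdiff, Nat.cast_sub (Finset.card_le_card Finset.inter_subset_right), hB]
    rw [hρ, mul_min_of_nonneg _ _ (by positivity), le_min_iff]
    constructor
    · have := real_depEvent_inter_le_mul_inv_pow hp t A B
      rwa [← hμ, hπeq A hA, hπeq B hB, ← sq] at this
    · have := real_depEvent_inter_le_mul_exp hp t A B hs
      rw [← hμ, hπeq A hA, hBA, hB] at this
      refine this.trans ?_
      rw [← mul_div_assoc, le_div_iff₀ hq₀, sq]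
      calc _ = π * q₀ * Real.exp ((k - (A ∩ B).card) / 2 *
            (s * t + (k - 1) * Real.log (1 - p + p * Real.exp (-s)))) := by ring
        _ ≤ _ := by gcongr
  set C : ℝ := (U.card.choose k : ℝ) with hC
  have hCpos : 0 < C := by
    rw [hC]; exact_mod_cast Nat.choose_pos (by omega)
  have hterm : ∀ l ∈ Finset.Icc 2 k,
      (k.choose l * (U.card - k).choose (k - l) : ℝ) * ρ l ≤ C * (R / k) := by
    intro l hl
    calc (k.choose l * (U.card - k).choose (k - l) : ℝ) * ρ l
        ≤ ((2 * k ^ 3 / U.card) ^ l * C) * ρ l :=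
          mul_le_mul_of_nonneg_right (choose_mul_choose_le_pow_mul (Finset.mem_Icc.1 hl).2 hU
            (by omega)) (hρpos l).le
      _ = C * ((2 * k ^ 3 / U.card) ^ l * ρ l) := by ring
      _ ≤ _ := mul_le_mul_of_nonneg_left (hR l hl) hCpos.le
  have hkk := hterm k (Finset.mem_Icc.2 ⟨hk, le_rfl⟩)
  have hπρ : 1 ≤ π * ρ k := by
    have := hpair B₀ B₀ hB₀ hB₀
    rw [Set.inter_self, Finset.inter_self, hB₀] at this
    refine le_of_mul_le_mul_left (a := π) ?_ hπpos
    linarith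
  simp only [Nat.choose_self, Nat.sub_self, Nat.choose_zero_right, Nat.cast_one, one_mul] at hkk
  have hRpos : 0 < R := by
    have h1 : 0 < C * (R / k) := (hρpos k).trans_le hkk
    have h2 : 0 < R / k := (mul_pos_iff_of_pos_left hCpos).1 h1
    exact (div_pos_iff_of_pos_right hkR).1 h2
  have hRk : R / k ≤ R := div_le_self hRpos.le (by exact_mod_cast (by omega : 1 ≤ k))
  have hM : C * π = ∑ S ∈ U.powersetCard k, μ.real (depEvent t S) := by
    rw [Finset.sum_congr rfl fun S hS => hπeq S (Finset.mem_powersetCard.1 hS).2,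
      Finset.sum_const, Finset.card_powersetCard, nsmul_eq_mul]
  refine bernoulliPi_real_forall_notMem_le_exp_neg (fun _ => hp')
    (fun S => isLowerSet_depEvent t S) (fun S => dependsOn_depEvent t S) (U.powersetCard k) hRpos
    hM ?_ ?_
  · calc 1 ≤ π * ρ k := hπρ
      _ ≤ π * (C * R) := by gcongr; exact hkk.trans (by gcongr)
      _ = _ := by ring
  · have hrow : ∀ A ∈ U.powersetCard k, ∑ B ∈ U.powersetCard k,
        (if A ≠ B ∧ ¬ Disjoint (edgesIn A) (edgesIn B) then
          μ.real (depEvent t A ∩ depEvent t B) else 0) ≤ π ^ 2 * (C * R) := by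
      intro A hA
      obtain ⟨hAU, hAk⟩ := Finset.mem_powersetCard.1 hA
      calc _ ≤ ∑ B ∈ U.powersetCard k, ∑ l ∈ Finset.Icc 2 k,
            if (A ∩ B).card = l then π ^ 2 * ρ l else 0 := by
            refine Finset.sum_le_sum fun B hB => ?_
            obtain ⟨hBU, hBk⟩ := Finset.mem_powersetCard.1 hB
            rw [Finset.sum_ite_eq]
            have hle : (A ∩ B).card ≤ k := hAk ▸ Finset.card_le_card Finset.inter_subset_left
            split_ifs with h1 h2 h2
            · exact hpair A B hAk hBk
            · rw [Finset.mem_Icc, not_and_or] at h2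
              exact absurd (disjoint_edgesIn (by omega)) h1.2
            · exact mul_nonneg (by positivity) (hρpos _).le
            · exact le_rfl
        _ = ∑ l ∈ Finset.Icc 2 k,
            ((U.powersetCard k).filter fun B => (A ∩ B).card = l).card * (π ^ 2 * ρ l) := by
            rw [Finset.sum_comm]
            refine Finset.sum_congr rfl fun l _ => ?_
            rw [← Finset.sum_filter, Finset.sum_const, nsmul_eq_mul]
        _ ≤ ∑ l ∈ Finset.Icc 2 k, π ^ 2 * (C * (R / k)) := by
            refine Finset.sum_le_sum fun l hl => ?_
            have h1 : ((((U.powersetCard k).filter fun B => (A ∩ B).card = l).card : ℕ) : ℝ)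
                ≤ k.choose l * (U.card - k).choose (k - l) := by
              have := card_filter_card_inter_eq_le hAU k l
              rw [hAk] at this
              exact_mod_cast this
            calc _ ≤ (k.choose l * (U.card - k).choose (k - l) : ℝ) * (π ^ 2 * ρ l) :=
                  mul_le_mul_of_nonneg_right h1 (mul_nonneg (by positivity) (hρpos _).le)
              _ = π ^ 2 * ((k.choose l * (U.card - k).choose (k - l) : ℝ) * ρ l) := by ring
              _ ≤ _ := mul_le_mul_of_nonneg_left (hterm l hl) (by positivity)
        _ ≤ k * (π ^ 2 * (C * (R / k))) := by
            rw [Finset.sum_const, nsmul_eq_mul, Nat.card_Icc]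
            refine mul_le_mul_of_nonneg_right ?_ (by positivity)
            exact_mod_cast (by omega : k + 1 - 2 ≤ k)
        _ = _ := by field_simp
    refine (Finset.sum_le_card_nsmul _ _ _ hrow).trans (le_of_eq ?_)
    rw [Finset.card_powersetCard, nsmul_eq_mul]
    ring

end Moments

section Duality

variable {p x : ℝ}

theorem LambdaStar_self (hp : p ∈ Set.Ioo (0 : ℝ) 1) : LambdaStar p p = 0 := by
  have h1 : 1 - p ≠ 0 := by linarith [hp.2]
  simp [LambdaStar, div_self hp.1.ne', div_self h1]

theorem LambdaStar_zero_right (p : ℝ) : LambdaStar p 0 = -Real.log (1 - p) := by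
  simp [LambdaStar]

theorem sub_le_mul_log_div {a b : ℝ} (ha : 0 ≤ a) (hb : 0 < b) : a - b ≤ a * Real.log (a / b) := by
  rcases ha.eq_or_lt with rfl | ha
  · simpa using hb.le
  · have h := mul_le_mul_of_nonneg_left (Real.one_sub_inv_le_log_of_pos (div_pos ha hb)) ha.le
    rw [inv_div, mul_sub, mul_div_cancel₀ _ ha.ne', mul_one] at h
    exact h

theorem LambdaStar_nonneg (hp : p ∈ Set.Ioo (0 : ℝ) 1) (hx : x ∈ Set.Icc (0 : ℝ) 1) :
    0 ≤ LambdaStar p x := by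
  have h1 := sub_le_mul_log_div hx.1 hp.1
  have h2 := sub_le_mul_log_div (sub_nonneg.2 hx.2) (sub_pos.2 hp.2)
  unfold LambdaStar
  linarith

theorem one_sub_add_mul_exp_pos (hp : p ∈ Set.Ioo (0 : ℝ) 1) (s : ℝ) :
    0 < 1 - p + p * Real.exp (-s) := by
  have := mul_pos hp.1 (Real.exp_pos (-s))
  linarith [hp.2]

/-- Exponential tilting of the rate function. -/
theorem LambdaStar_tilt (hp : p ∈ Set.Ioo (0 : ℝ) 1) (hx : x ∈ Set.Icc (0 : ℝ) 1) (s : ℝ) :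
    LambdaStar (p * Real.exp (-s) / (1 - p + p * Real.exp (-s))) x
      = LambdaStar p x + s * x + Real.log (1 - p + p * Real.exp (-s)) := by
  set Z := 1 - p + p * Real.exp (-s) with hZ
  have hZ0 : 0 < Z := one_sub_add_mul_exp_pos hp s
  have hp1 : 0 < 1 - p := by linarith [hp.2]
  have h1 : x * Real.log (x / (p * Real.exp (-s) / Z))
      = x * Real.log (x / p) + x * s + x * Real.log Z := by
    rcases hx.1.eq_or_lt with rfl | h
    · simp
    · rw [Real.log_div h.ne' (by have := hp.1; positivity),
        Real.log_div (mul_pos hp.1 (Real.exp_pos _)).ne' hZ0.ne',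
        Real.log_mul hp.1.ne' (Real.exp_pos _).ne', Real.log_exp, Real.log_div h.ne' hp.1.ne']
      ring
  have h2 : (1 - x) * Real.log ((1 - x) / (1 - p * Real.exp (-s) / Z))
      = (1 - x) * Real.log ((1 - x) / (1 - p)) + (1 - x) * Real.log Z := by
    have h3 : 1 - p * Real.exp (-s) / Z = (1 - p) / Z := by
      field_simp
      rw [hZ]
      ring
    rw [h3]
    rcases (sub_nonneg.2 hx.2).eq_or_lt with h | h
    · simp [← h]
    · rw [Real.log_div h.ne' (by positivity), Real.log_div hp1.ne' hZ0.ne',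
        Real.log_div h.ne' hp1.ne']
      ring
  unfold LambdaStar
  rw [h1, h2]
  ring

theorem neg_log_sub_le_LambdaStar (hp : p ∈ Set.Ioo (0 : ℝ) 1) (hx : x ∈ Set.Icc (0 : ℝ) 1)
    (s : ℝ) : -Real.log (1 - p + p * Real.exp (-s)) - s * x ≤ LambdaStar p x := by
  have hZ0 := one_sub_add_mul_exp_pos hp s
  have h := LambdaStar_nonneg (p := p * Real.exp (-s) / (1 - p + p * Real.exp (-s)))
    ⟨div_pos (mul_pos hp.1 (Real.exp_pos _)) hZ0, (div_lt_one hZ0).2 (by linarith [hp.2])⟩ hx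
  rw [LambdaStar_tilt hp hx] at h
  linarith

theorem exists_LambdaStar_sub_le (hp : p ∈ Set.Ioo (0 : ℝ) 1) (hx : x ∈ Set.Ico 0 p) {η : ℝ}
    (hη : 0 < η) :
    ∃ s, 0 ≤ s ∧ LambdaStar p x - η ≤ -Real.log (1 - p + p * Real.exp (-s)) - s * x := by
  have hp1 : 0 < 1 - p := by linarith [hp.2]
  rcases hx.1.eq_or_lt with rfl | hx0
  · have h1 : Tendsto (fun s : ℝ => -Real.log (1 - p + p * Real.exp (-s))) atTop
        (nhds (-Real.log (1 - p + p * 0))) :=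
      ((Real.tendsto_exp_neg_atTop_nhds_zero.const_mul p).const_add (1 - p)).log
        (by simpa using hp1.ne') |>.neg
    rw [mul_zero, add_zero, ← LambdaStar_zero_right] at h1
    obtain ⟨s, hs, hs0⟩ := ((h1.eventually (lt_mem_nhds (sub_lt_self _ hη))).and
      (eventually_ge_atTop 0)).exists
    exact ⟨s, hs0, by simpa using hs.le⟩
  · have hx1 : 0 < 1 - x := by linarith [hx.2]
    refine ⟨Real.log (p * (1 - x) / ((1 - p) * x)), Real.log_nonneg ?_, ?_⟩
    · rw [one_le_div (by positivity)]
      nlinarith [hx.2]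
    · set s := Real.log (p * (1 - x) / ((1 - p) * x)) with hs
      have hexp : p * Real.exp (-s) = (1 - p) * x / (1 - x) := by
        have := hp.1
        rw [Real.exp_neg, hs, Real.exp_log (by positivity)]
        field_simp
      have htilt : p * Real.exp (-s) / (1 - p + p * Real.exp (-s)) = x := by
        rw [hexp]
        field_simp
        ring
      have h := LambdaStar_tilt hp ⟨hx.1, by linarith⟩ s
      rw [htilt, LambdaStar_self ⟨hx0, by linarith⟩] at h
      linarith

theorem LambdaStar_antitoneOn (hp : p ∈ Set.Ioo (0 : ℝ) 1) :
    AntitoneOn (LambdaStar p) (Set.Ico 0 p) := by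
  intro x hx y hy hxy
  refine le_of_forall_pos_sub_le fun η hη => ?_
  obtain ⟨s, hs, h⟩ := exists_LambdaStar_sub_le hp hy hη
  have h1 := neg_log_sub_le_LambdaStar hp ⟨hx.1, (hx.2.trans hp.2).le⟩ s
  have h2 := mul_le_mul_of_nonneg_left hxy hs
  linarith

end Duality

section LowerBound

theorem depEvent_of_forall_eq_false {V : Type*} [DecidableEq V] (t : ℕ) (B : Finset V) :
    {ω : Sym2 V → Bool | ∀ e ∈ edgesIn B, ω e = false} ⊆ depEvent t B := by
  intro ω hω v hv
  rw [Finset.card_eq_zero.2]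
  · exact Nat.zero_le t
  · refine Finset.filter_eq_empty_iff.2 fun e he => ?_
    induction e with
    | _ a b =>
      rw [mem_starIn] at he
      rw [hω _ (mem_edgesIn.2 (by grind))]
      simp

theorem choose_two_le_sq_div_two (k : ℕ) : (k.choose 2 : ℝ) ≤ (k : ℝ) ^ 2 / 2 := by
  rw [Nat.cast_choose_two]
  have : (0 : ℝ) ≤ k := k.cast_nonneg
  nlinarith

/-- The probability that a fixed set of `k` vertices is `t`-dependent decays no faster than the
rate function predicts. -/
theorem exists_exp_le_real_depEvent {p x : ℝ} (hp : p ∈ Set.Ioo (0 : ℝ) 1) (hx : x ∈ Set.Ico 0 p)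
    {η : ℝ} (hη : 0 < η) :
    ∃ δ > 0, ∀ᶠ k : ℕ in atTop, ∀ t : ℕ, (x - δ) * k ≤ t → ∀ (n : ℕ) (B : Finset (Fin n)),
      B.card = k → Real.exp (-((k : ℝ) ^ 2 / 2 * (LambdaStar p x + η))) ≤
        (bernoulliPi fun _ : Sym2 (Fin n) => p).real (depEvent t B) := by
  have hp' : p ∈ Set.Icc (0 : ℝ) 1 := ⟨hp.1.le, hp.2.le⟩
  have hp1 : 0 < 1 - p := by linarith [hp.2]
  have hΛ := LambdaStar_nonneg hp ⟨hx.1, (hx.2.trans hp.2).le⟩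
  rcases hx.1.eq_or_lt with rfl | hx0
  · refine ⟨1, one_pos, Eventually.of_forall fun k t _ n B hB => ?_⟩
    have := isProbabilityMeasure_bernoulliPi (P := fun _ : Sym2 (Fin n) => p) fun _ => hp'
    refine le_trans ?_ (measureReal_mono (depEvent_of_forall_eq_false t B))
    rw [bernoulliPi_real_forall_eq_false fun _ => hp', Finset.prod_const, card_edgesIn, hB,
      ← Real.exp_log (pow_pos hp1 _), Real.log_pow]
    refine Real.exp_le_exp.2 ?_
    rw [LambdaStar_zero_right] at hΛ ⊢
    have h1 := mul_le_mul_of_nonneg_right (choose_two_le_sq_div_two k) hΛ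
    have h2 : 0 ≤ (k : ℝ) ^ 2 / 2 * η := by positivity
    linarith
  · have hx1 : 0 < 1 - x := by linarith [hx.2, hp.2]
    set g : ℝ → ℝ := fun d => (x - 2 * d) * Real.log (p / (x - d)) +
      (1 - (x - 2 * d)) * Real.log ((1 - p) / (1 - (x - d))) with hg
    have hg0 : g 0 = -LambdaStar p x := by
      simp only [hg, mul_zero, sub_zero, LambdaStar]
      rw [← inv_div x p, ← inv_div (1 - x), Real.log_inv, Real.log_inv]
      ring
    have hgc : ContinuousAt g 0 := by
      have h1 : p / (x - 0) ≠ 0 := by simp [hp.1.ne', hx0.ne']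
      have h2 : (1 - p) / (1 - (x - 0)) ≠ 0 := by simp [hp1.ne', hx1.ne']
      have h3 : x - 0 ≠ 0 := by simp [hx0.ne']
      have h4 : 1 - (x - 0) ≠ 0 := by simp [hx1.ne']
      fun_prop (disch := assumption)
    have hev : ∀ᶠ d in nhdsWithin 0 (Set.Ioi 0), -(LambdaStar p x + η / 2) < g d ∧ d < x / 3 :=
      nhdsWithin_le_nhds ((hgc.eventually (lt_mem_nhds (by rw [hg0]; linarith))).and
        (gt_mem_nhds (by positivity)))
    obtain ⟨d, ⟨hgd, hdx⟩, hd : 0 < d⟩ := (hev.and self_mem_nhdsWithin).exists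
    set r := x - d with hr
    set θ := x - 2 * d with hθ
    have hr0 : 0 < r := by linarith
    have hθ0 : 0 < θ := by linarith
    set y := x - d / 2 with hy
    have hy0 : 0 < y := by linarith
    have hs : 0 ≤ Real.log (y / r) := Real.log_nonneg ((one_le_div hr0).2 (by linarith))
    have hu : 0 ≤ Real.log (r / θ) := Real.log_nonneg ((one_le_div hθ0).2 (by linarith))
    have ha : r * (Real.exp (Real.log (y / r)) - 1) - Real.log (y / r) * y < 0 := by
      rw [Real.exp_log (by positivity), mul_sub, mul_div_cancel₀ _ hr0.ne']
      have h1 := Real.log_lt_sub_one_of_pos (div_pos hr0 hy0)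
        ((div_lt_one hy0).2 (by linarith)).ne
      rw [← inv_div, Real.log_inv, lt_sub_iff_add_lt, inv_div, lt_div_iff₀ hy0] at h1
      linarith
    have hb : r * (Real.exp (-Real.log (r / θ)) - 1) + Real.log (r / θ) * θ < 0 := by
      rw [Real.exp_neg, Real.exp_log (by positivity), inv_div, mul_sub, mul_div_cancel₀ _ hr0.ne']
      have h1 := Real.log_lt_sub_one_of_pos (div_pos hr0 hθ0)
        ((one_lt_div hθ0).2 (by linarith)).ne'
      rw [lt_sub_iff_add_lt, lt_div_iff₀ hθ0] at h1
      linarith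
    set s := Real.log (y / r) with hsdef
    set u := Real.log (r / θ) with hudef
    set a := r * (Real.exp s - 1) - s * y with hadef
    set b := r * (Real.exp (-u) - 1) + u * θ with hbdef
    refine ⟨d / 2, by positivity, ?_⟩
    have hk : Tendsto (fun k : ℕ => (k : ℝ)) atTop atTop := tendsto_natCast_atTop_atTop
    have hA : Tendsto (fun k : ℕ => (k : ℝ) * Real.exp (a * k)) atTop (nhds 0) := by
      have := (tendsto_rpow_mul_exp_neg_mul_atTop_nhds_zero 1 (-a) (by linarith)).comp hk
      simpa [Function.comp_def] using this
    have hB : Tendsto (fun k : ℕ => Real.exp ((k.choose 2 : ℝ) * b)) atTop (nhds 0) := by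
      refine Real.tendsto_exp_atBot.comp (Tendsto.atTop_mul_const_of_neg hb ?_)
      refine tendsto_natCast_atTop_atTop.comp (tendsto_atTop_mono' _ ?_ (tendsto_sub_atTop_nat 1))
      filter_upwards [eventually_ge_atTop 2] with k hk2
      rw [Nat.choose_two_right, Nat.le_div_iff_mul_le two_pos, mul_comm]
      exact Nat.mul_le_mul_right _ hk2
    have hC : Tendsto (fun k : ℕ => (k : ℝ) ^ 2 * (η / 4)) atTop atTop :=
      ((tendsto_pow_atTop two_ne_zero).comp hk).atTop_mul_const (by positivity)
    filter_upwards [hA.eventually (gt_mem_nhds (by norm_num : (0 : ℝ) < 1 / 4)),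
      hB.eventually (gt_mem_nhds (by norm_num : (0 : ℝ) < 1 / 4)),
      hC.eventually_ge_atTop (Real.log 2)] with k hkA hkB hkC t ht n B hBk
    refine le_trans ?_ (le_real_depEvent hp ⟨hr0, by linarith [hx.2]⟩ t B hs hu (θ := θ))
    rw [hBk, ← hbdef]
    have h1 : (k : ℝ) * Real.exp (k * (r * (Real.exp s - 1)) - s * t) ≤ 1 / 4 := by
      refine le_trans ?_ hkA.le
      refine mul_le_mul_of_nonneg_left (Real.exp_le_exp.2 ?_) k.cast_nonneg
      have := mul_le_mul_of_nonneg_left ht hs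
      rw [hadef, hy]
      linarith
    have h2 : -((k : ℝ) ^ 2 / 2 * (LambdaStar p x + η / 2)) ≤ k.choose 2 *
        (θ * Real.log (p / r) + (1 - θ) * Real.log ((1 - p) / (1 - r))) := by
      have h3 := mul_le_mul_of_nonneg_left hgd.le (k.choose 2).cast_nonneg (α := ℝ)
      have h4 := mul_le_mul_of_nonneg_right (choose_two_le_sq_div_two k)
        (by positivity : 0 ≤ LambdaStar p x + η / 2)
      have h5 : g d = θ * Real.log (p / r) + (1 - θ) * Real.log ((1 - p) / (1 - r)) := rfl
      rw [← h5]
      linarith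
    calc Real.exp (-((k : ℝ) ^ 2 / 2 * (LambdaStar p x + η)))
        ≤ Real.exp (-Real.log 2 + -((k : ℝ) ^ 2 / 2 * (LambdaStar p x + η / 2))) :=
          Real.exp_le_exp.2 (by linarith)
      _ = 1 / 2 * Real.exp (-((k : ℝ) ^ 2 / 2 * (LambdaStar p x + η / 2))) := by
          rw [Real.exp_add, Real.exp_neg, Real.exp_log two_pos, one_div]
      _ ≤ _ := mul_le_mul (by linarith) (Real.exp_le_exp.2 h2) (Real.exp_pos _).le (by linarith)

end LowerBound

section Asymptotics

theorem second_moment_term_le {p : ℝ} (hp : p ∈ Set.Ioo (0 : ℝ) 1) {k l : ℕ}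
    {M w lam η θ d L : ℝ} (hl : l ∈ Set.Icc 2 k) (hL : 0 ≤ L) (hη : 0 ≤ η) (hd : 0 < d)
    (hθ0 : 0 ≤ θ) (hθ : θ ≤ 1 / 12) (hM0 : 0 ≤ M) (hM : M ≤ Real.exp (-((1 - θ) * L)))
    (hdk : -Real.log (1 - p) * (d * k) / 2 ≤ θ * L) (hw : w ≤ -(k * (lam - 2 * η)))
    (hlam : k / 2 * (lam + 3 * η / d) ≤ (1 - 2 * θ) * L) (hk : 5 / 3 ≤ θ * (d * k))
    (hkL : k ≤ Real.exp (L / 3)) :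
    M ^ l * min ((1 - p)⁻¹ ^ l.choose 2)
      (Real.exp ((k - l) / 2 * w) / Real.exp (-((k : ℝ) ^ 2 / 2 * (lam + η))))
      ≤ Real.exp (-(4 / 3 * L)) / k := by
  have hp1 : 0 < 1 - p := by linarith [hp.2]
  have hγ : 0 ≤ -Real.log (1 - p) := by linarith [Real.log_nonpos hp1.le (by linarith [hp.1])]
  have hl2 : (2 : ℝ) ≤ l := by exact_mod_cast hl.1
  have hlk : (l : ℝ) ≤ k := by exact_mod_cast hl.2
  have hk0 : (0 : ℝ) < k := by linarith
  have hMl : M ^ l ≤ Real.exp (l * -((1 - θ) * L)) := by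
    rw [Real.exp_nat_mul]
    exact pow_le_pow_left₀ hM0 hM l
  have hmain : ∀ E : ℝ, E ≤ l * ((1 - θ) * L) - 5 / 3 * L →
      M ^ l * Real.exp E ≤ Real.exp (-(4 / 3 * L)) / k := by
    intro E hE
    rw [le_div_iff₀ hk0]
    calc M ^ l * Real.exp E * k
        ≤ Real.exp (l * -((1 - θ) * L)) * Real.exp E * Real.exp (L / 3) := by gcongr
      _ = Real.exp (l * -((1 - θ) * L) + E + L / 3) := by rw [Real.exp_add, Real.exp_add]
      _ ≤ _ := Real.exp_le_exp.2 (by linarith)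
  rcases lt_or_ge (l : ℝ) (d * k) with h | h
  · refine (mul_le_mul_of_nonneg_left (min_le_left _ _) (by positivity)).trans ?_
    rw [← Real.exp_log (pow_pos (inv_pos.2 hp1) _), Real.log_pow, Real.log_inv]
    refine hmain _ ?_
    have h1 := mul_le_mul_of_nonneg_right (choose_two_le_sq_div_two l) hγ
    have h2 := mul_le_mul_of_nonneg_right h.le hγ
    have h3 : (l : ℝ) * (l * -Real.log (1 - p)) ≤ l * (2 * (θ * L)) :=
      mul_le_mul_of_nonneg_left (by linarith) (by linarith)
    have h4 : 2 * ((1 - 2 * θ) * L) ≤ l * ((1 - 2 * θ) * L) :=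
      mul_le_mul_of_nonneg_right hl2 (mul_nonneg (by linarith) hL)
    have h5 : θ * L ≤ 1 / 12 * L := mul_le_mul_of_nonneg_right hθ hL
    linarith
  · refine (mul_le_mul_of_nonneg_left (min_le_right _ _) (by positivity)).trans ?_
    rw [← Real.exp_sub]
    refine hmain _ ?_
    have h1 : ((k : ℝ) - l) / 2 * w ≤ (k - l) / 2 * -(k * (lam - 2 * η)) :=
      mul_le_mul_of_nonneg_left hw (by linarith)
    have h2 : (k : ℝ) ≤ l / d := by rwa [le_div_iff₀ hd, mul_comm]
    have h3 : (k : ℝ) * η * k ≤ k * η * (l / d) := mul_le_mul_of_nonneg_left h2 (by positivity)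
    have h4 := mul_le_mul_of_nonneg_left hlam (by linarith : (0 : ℝ) ≤ l)
    have h5 : (l : ℝ) * (k / 2 * (lam + 3 * η / d))
      = l * k / 2 * lam + 3 / 2 * (k * η * (l / d)) := by ring
    have h6 : 0 ≤ (k : ℝ) * l * η := by positivity
    have h7 : 5 / 3 * L ≤ θ * l * L := by
      refine mul_le_mul_of_nonneg_right (hk.trans ?_) hL
      exact mul_le_mul_of_nonneg_left h hθ0
    linarith

theorem tendsto_log_natCast_atTop : Tendsto (fun n : ℕ => Real.log n) atTop atTop :=
  Real.tendsto_log_atTop.comp tendsto_natCast_atTop_atTop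

theorem tendsto_div_log_of_abs_sub_le {κ : ℝ} {k : ℕ → ℕ}
    (hk : ∀ n, |(k n : ℝ) - κ * Real.log n| ≤ 1) :
    Tendsto (fun n => (k n : ℝ) / Real.log n) atTop (nhds κ) := by
  rw [tendsto_iff_norm_sub_tendsto_zero]
  refine squeeze_zero' (Eventually.of_forall fun _ => norm_nonneg _) ?_
    (tendsto_inv_atTop_zero.comp tendsto_log_natCast_atTop)
  filter_upwards [tendsto_log_natCast_atTop.eventually_gt_atTop 0] with n hn
  have h : (k n : ℝ) / Real.log n - κ = (k n - κ * Real.log n) / Real.log n := by field_simp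
  rw [h, norm_div, Real.norm_of_nonneg hn.le, Function.comp_apply, ← one_div]
  exact div_le_div_of_nonneg_right (hk n) hn.le

theorem tendsto_atTop_of_tendsto_div_log {κ : ℝ} (hκ : 0 < κ) {k : ℕ → ℕ}
    (hk : Tendsto (fun n => (k n : ℝ) / Real.log n) atTop (nhds κ)) :
    Tendsto (fun n => (k n : ℝ)) atTop atTop := by
  refine (hk.pos_mul_atTop hκ tendsto_log_natCast_atTop).congr' ?_
  filter_upwards [tendsto_log_natCast_atTop.eventually_gt_atTop 0] with n hn
  field_simp

variable {p τ κ : ℝ} {t k : ℕ → ℕ}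

/-- First moment: above the threshold there are no large `t`-dependent sets. -/
theorem tendsto_real_exists_depEvent (hp : p ∈ Set.Ioo (0 : ℝ) 1) (hκ : 0 < κ) {s : ℝ}
    (hs : 0 ≤ s) (hsκ : 2 < -κ * Real.log (1 - p + p * Real.exp (-s)) - s * τ)
    (ht : Tendsto (fun n => (t n : ℝ) / Real.log n) atTop (nhds τ))
    (hk : Tendsto (fun n => (k n : ℝ) / Real.log n) atTop (nhds κ)) :
    Tendsto (fun n : ℕ => (bernoulliPi fun _ : Sym2 (Fin n) => p).real
      {ω | ∃ S : Finset (Fin n), S.card = k n ∧ ω ∈ depEvent (t n) S}) atTop (nhds 0) := by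
  set z := Real.log (1 - p + p * Real.exp (-s)) with hz
  have hlog := tendsto_log_natCast_atTop
  have hinv : Tendsto (fun n : ℕ => (Real.log n)⁻¹) atTop (nhds 0) :=
    tendsto_inv_atTop_zero.comp hlog
  have h1 : Tendsto (fun n : ℕ => 1 + (s * (t n / Real.log n) +
      (k n / Real.log n - (Real.log n)⁻¹) * z) / 2) atTop
      (nhds (1 + (s * τ + (κ - 0) * z) / 2)) :=
    ((((ht.const_mul s).add ((hk.sub hinv).mul_const z)).div_const 2).const_add 1)
  have hneg : 1 + (s * τ + (κ - 0) * z) / 2 < 0 := by linarith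
  have h2 : Tendsto (fun n : ℕ => Real.log n + (s * t n + (k n - 1) * z) / 2) atTop atBot := by
    refine (h1.neg_mul_atTop hneg hlog).congr' ?_
    filter_upwards [hlog.eventually_gt_atTop 0] with n hn
    field_simp
  have hkt := tendsto_atTop_of_tendsto_div_log hκ hk
  refine squeeze_zero' (Eventually.of_forall fun _ => measureReal_nonneg) ?_
    (Real.tendsto_exp_atBot.comp (hkt.atTop_mul_atBot₀ h2))
  filter_upwards [eventually_gt_atTop 0] with n hn
  simpa using real_exists_depEvent_le hp (t n) (k n) (V := Fin n) hs (by simpa using hn)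

theorem eventually_mul_log_pow_le_exp (C : ℝ) (j : ℕ) {θ : ℝ} (hθ : 0 < θ) :
    ∀ᶠ n : ℕ in atTop, C * Real.log n ^ j ≤ Real.exp (θ * Real.log n) := by
  have h := ((tendsto_rpow_mul_exp_neg_mul_atTop_nhds_zero j θ hθ).comp
    tendsto_log_natCast_atTop).const_mul C
  rw [mul_zero] at h
  filter_upwards [h.eventually (gt_mem_nhds one_pos)] with n hn
  rw [Function.comp_apply, Real.rpow_natCast, neg_mul, Real.exp_neg, ← div_eq_mul_inv,
    ← mul_div_assoc, div_lt_one (Real.exp_pos _)] at hn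
  exact hn.le

/-- Below the threshold, every moderately large set of vertices contains a large `t`-dependent
set. -/
theorem tendsto_real_exists_forall_notMem_depEvent (hp : p ∈ Set.Ioo (0 : ℝ) 1) (hτ : 0 ≤ τ)
    (hκ : 0 < κ) (hκτ : τ / κ < p) (hκΛ : κ * LambdaStar p (τ / κ) < 2)
    (ht : Tendsto (fun n => (t n : ℝ) / Real.log n) atTop (nhds τ))
    (hk : Tendsto (fun n => (k n : ℝ) / Real.log n) atTop (nhds κ)) :
    Tendsto (fun n : ℕ => (bernoulliPi fun _ : Sym2 (Fin n) => p).real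
      {ω | ∃ U : Finset (Fin n), U.card = ⌈(n : ℝ) / Real.log n ^ 2⌉₊ ∧
        ∀ S ∈ U.powersetCard (k n), ω ∉ depEvent (t n) S}) atTop (nhds 0) := by
  have hp' : p ∈ Set.Icc (0 : ℝ) 1 := ⟨hp.1.le, hp.2.le⟩
  set x := τ / κ with hxdef
  have hx : x ∈ Set.Ico 0 p := ⟨by positivity, hκτ⟩
  set lam := LambdaStar p x with hlam
  set γ := -Real.log (1 - p) with hγdef
  have hγ : 0 < γ := neg_pos.2 (Real.log_neg (by linarith [hp.2]) (by linarith [hp.1]))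
  obtain ⟨θ, hθ0, hθ12, hθ⟩ : ∃ θ : ℝ, 0 < θ ∧ θ ≤ 1 / 12 ∧ κ / 2 * lam < 1 - 2 * θ :=
    ⟨min (1 / 12) ((2 - κ * lam) / 8), lt_min (by norm_num) (by linarith), min_le_left _ _, by
      linarith [min_le_right (1 / 12) ((2 - κ * lam) / 8)]⟩
  obtain ⟨d, hd0, hd⟩ : ∃ d : ℝ, 0 < d ∧ γ * (d * κ) / 2 < θ :=
    ⟨θ / (γ * κ), by positivity, by field_simp; linarith⟩
  obtain ⟨η, hη0, hη⟩ : ∃ η : ℝ, 0 < η ∧ κ / 2 * (lam + 3 * η / d) < 1 - 2 * θ := by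
    refine ⟨d * (1 - 2 * θ - κ / 2 * lam) / (3 * κ), ?_, ?_⟩
    · have : 0 < 1 - 2 * θ - κ / 2 * lam := by linarith
      positivity
    · field_simp
      linarith
  obtain ⟨s, hs, hsη⟩ := exists_LambdaStar_sub_le hp hx hη0
  obtain ⟨δ, hδ, hπ⟩ := exists_exp_le_real_depEvent hp hx hη0
  set z := Real.log (1 - p + p * Real.exp (-s)) with hz
  have hlog := tendsto_log_natCast_atTop
  have hkt := tendsto_atTop_of_tendsto_div_log hκ hk
  have htk : Tendsto (fun n => (t n : ℝ) / k n) atTop (nhds x) := by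
    refine (ht.div hk hκ.ne').congr' ?_
    filter_upwards [hlog.eventually_gt_atTop 0] with n hn
    simp only [Pi.div_apply]
    field_simp
  have ew : ∀ᶠ n in atTop, s * t n + (k n - 1) * z ≤ -(k n * (lam - 2 * η)) := by
    have h : Tendsto (fun n => s * ((t n : ℝ) / k n) + (1 - (k n : ℝ)⁻¹) * z) atTop
        (nhds (s * x + (1 - 0) * z)) :=
      (htk.const_mul s).add (((tendsto_inv_atTop_zero.comp hkt).const_sub 1).mul_const z)
    have h0 : s * x + (1 - 0) * z < -(lam - 2 * η) := by linarith
    filter_upwards [h.eventually (gt_mem_nhds h0),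
      hkt.eventually_gt_atTop 0] with n hn hkn
    have := mul_le_mul_of_nonneg_left hn.le hkn.le
    rw [mul_add, ← mul_assoc, ← mul_assoc (k n : ℝ), mul_sub, mul_inv_cancel₀ hkn.ne'] at this
    have h3 : (k n : ℝ) * s * (t n / k n) = s * t n := by field_simp
    linarith
  have hrate : ∀ {c C : ℝ}, κ * c < C → ∀ᶠ n in atTop, k n * c ≤ C * Real.log n := by
    intro c C h
    filter_upwards [(hk.mul_const c).eventually (gt_mem_nhds h), hlog.eventually_gt_atTop 0]
      with n hn hn0
    rw [div_mul_eq_mul_div, div_lt_iff₀ hn0] at hn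
    exact hn.le
  have hbound : ∀ᶠ n : ℕ in atTop, 0 < Real.log n ∧
      (2 ≤ k n ∧ 2 * k n ≤ ⌈(n : ℝ) / Real.log n ^ 2⌉₊) ∧
      (2 * k n ^ 3 / (⌈(n : ℝ) / Real.log n ^ 2⌉₊ : ℝ)) ≤
        Real.exp (-((1 - θ) * Real.log n)) := by
    filter_upwards [hlog.eventually_ge_atTop 1, hkt.eventually_ge_atTop 2,
      eventually_mul_log_pow_le_exp (2 * (κ + 1) ^ 3) 5 hθ0,
      hrate (c := 1) (C := κ + 1) (by linarith), eventually_gt_atTop 0] with n hn1 hk2 hexp hkn hn0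
    have hL : 0 < Real.log n := by linarith
    have hn0' : (0 : ℝ) < n := by exact_mod_cast hn0
    have hm : (n : ℝ) / Real.log n ^ 2 ≤ ⌈(n : ℝ) / Real.log n ^ 2⌉₊ := Nat.le_ceil _
    have hkey : 2 * (k n : ℝ) ^ 3 * Real.log n ^ 2 ≤ Real.exp (θ * Real.log n) := by
      rw [mul_one] at hkn
      calc 2 * (k n : ℝ) ^ 3 * Real.log n ^ 2
          ≤ 2 * ((κ + 1) * Real.log n) ^ 3 * Real.log n ^ 2 := by gcongr
        _ = 2 * (κ + 1) ^ 3 * Real.log n ^ 5 := by ring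
        _ ≤ _ := hexp
    have hmpos : (0 : ℝ) < ⌈(n : ℝ) / Real.log n ^ 2⌉₊ := lt_of_lt_of_le (by positivity) hm
    have hM : 2 * (k n : ℝ) ^ 3 / (⌈(n : ℝ) / Real.log n ^ 2⌉₊ : ℝ) ≤
        Real.exp (-((1 - θ) * Real.log n)) := by
      rw [div_le_iff₀ hmpos]
      have h1 : Real.exp (-((1 - θ) * Real.log n)) * n = Real.exp (θ * Real.log n) := by
        nth_rewrite 2 [← Real.exp_log hn0']
        rw [← Real.exp_add]
        ring_nf
      calc 2 * (k n : ℝ) ^ 3 ≤ Real.exp (θ * Real.log n) / Real.log n ^ 2 := by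
            rwa [le_div_iff₀ (by positivity)]
        _ = Real.exp (-((1 - θ) * Real.log n)) * (n / Real.log n ^ 2) := by
            rw [← h1, mul_div_assoc]
        _ ≤ _ := by gcongr
    refine ⟨hL, ⟨by exact_mod_cast hk2, ?_⟩, hM⟩
    have h2 : 2 * (k n : ℝ) ^ 3 ≤ ⌈(n : ℝ) / Real.log n ^ 2⌉₊ := by
      have h3 : Real.exp (-((1 - θ) * Real.log n)) ≤ 1 :=
        Real.exp_le_one_iff.2 (by nlinarith)
      exact (div_le_one hmpos).1 (hM.trans h3)
    have h4 : (k n : ℝ) ≤ k n ^ 3 := le_self_pow₀ (by linarith) (by norm_num)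
    exact_mod_cast (by linarith : 2 * (k n : ℝ) ≤ ⌈(n : ℝ) / Real.log n ^ 2⌉₊)
  have hkL : ∀ᶠ n in atTop, (k n : ℝ) ≤ Real.exp (Real.log n / 3) := by
    filter_upwards [eventually_mul_log_pow_le_exp (κ + 1) 1 (θ := 1 / 3) (by norm_num),
      hrate (c := 1) (C := κ + 1) (by linarith)] with n h1 h2
    rw [pow_one] at h1
    rw [mul_one] at h2
    rw [div_eq_inv_mul, ← one_div]
    exact h2.trans h1
  have hexp4 : ∀ᶠ n : ℕ in atTop, 4 ≤ Real.exp (Real.log n / 3) :=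
    (Real.tendsto_exp_atTop.comp (hlog.atTop_div_const three_pos)).eventually_ge_atTop 4
  refine squeeze_zero' (Eventually.of_forall fun _ => measureReal_nonneg) ?_
    (Real.tendsto_exp_neg_atTop_nhds_zero.comp tendsto_natCast_atTop_atTop)
  filter_upwards [ew, hbound, hkL, hexp4, (tendsto_natCast_atTop_iff.1 hkt).eventually hπ,
    htk.eventually (lt_mem_nhds (sub_lt_self x hδ)),
    hrate (c := γ * d / 2) (C := θ) (by linarith),
    hrate (c := (lam + 3 * η / d) / 2) (C := 1 - 2 * θ) (by linarith),
    (hkt.const_mul_atTop (mul_pos hθ0 hd0)).eventually_ge_atTop (5 / 3), eventually_gt_atTop 0]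
    with n hw ⟨hL, ⟨hk2, hkm⟩, hM⟩ hkL h4 hπ htk hγd hld h53 hn0
  have := isProbabilityMeasure_bernoulliPi (P := fun _ : Sym2 (Fin n) => p) fun _ => hp'
  have hkpos : (0 : ℝ) < k n := by exact_mod_cast (by omega : 0 < k n)
  have hn0' : (0 : ℝ) < n := by exact_mod_cast hn0
  set m := ⌈(n : ℝ) / Real.log n ^ 2⌉₊ with hm
  have hset : {ω : Sym2 (Fin n) → Bool | ∃ U : Finset (Fin n), U.card = m ∧
        ∀ S ∈ U.powersetCard (k n), ω ∉ depEvent (t n) S}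
      = ⋃ U ∈ Finset.univ.powersetCard m,
        {ω | ∀ S ∈ U.powersetCard (k n), ω ∉ depEvent (t n) S} := by
    ext ω
    simp [Finset.mem_powersetCard]
  rw [hset]
  refine (measureReal_biUnion_finset_le _ _).trans ((Finset.sum_le_card_nsmul _ _
    (Real.exp (-(1 / (2 * Real.exp (-(4 / 3 * Real.log n)))))) ?_).trans ?_)
  · intro U hU
    obtain ⟨-, hU⟩ := Finset.mem_powersetCard.1 hU
    refine real_forall_notMem_depEvent_le hp (t n) hk2 (hU ▸ hkm) hs (Real.exp_pos _)
      (hπ (t n) ((lt_div_iff₀ hkpos).1 htk).le n) fun l hl => ?_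
    rw [hU]
    exact second_moment_term_le hp (Finset.mem_Icc.1 hl) hL.le hη0.le hd0 hθ0.le hθ12
      (by positivity) hM (by linarith) hw (by linarith) (by linarith) hkL
  · rw [Finset.card_powersetCard, Finset.card_univ, Fintype.card_fin, nsmul_eq_mul]
    have h1 : (n.choose m : ℝ) ≤ Real.exp n := by
      calc (n.choose m : ℝ) ≤ 2 ^ n := by exact_mod_cast Nat.choose_le_two_pow n m
        _ ≤ Real.exp 1 ^ n := by
          gcongr
          linarith [Real.exp_one_gt_d9]
        _ = _ := by rw [← Real.exp_nat_mul, mul_one]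
    have h2 : 2 * (n : ℝ) ≤ 1 / (2 * Real.exp (-(4 / 3 * Real.log n))) := by
      have h3 : 1 / (2 * Real.exp (-(4 / 3 * Real.log n))) = n * Real.exp (Real.log n / 3) / 2 := by
        nth_rewrite 2 [← Real.exp_log hn0']
        rw [← Real.exp_add, Real.exp_neg, one_div, mul_inv, inv_inv]
        ring_nf
      rw [h3]
      nlinarith
    calc _ ≤ Real.exp n * Real.exp (-(2 * n)) := by gcongr
      _ = _ := by
        rw [← Real.exp_add, Function.comp_apply]
        ring_nf

end Asymptotics

section Threshold

theorem erMeasure_eq_ofReal {n : ℕ} {p : ℝ} (hp : p ∈ Set.Icc (0 : ℝ) 1)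
    (A : Set (SimpleGraph (Fin n))) :
    erMeasure n p A = ENNReal.ofReal ((bernoulliPi fun _ : Sym2 (Fin n) => p).real
      {ω | SimpleGraph.fromEdgeSet {e | ω e = true} ∈ A}) := by
  have := isProbabilityMeasure_bernoulliPi (P := fun _ : Sym2 (Fin n) => p) fun _ => hp
  rw [ofReal_measureReal, erMeasure, Measure.map_apply (measurable_of_finite _)
    (MeasurableSpace.measurableSet_top (s := A))]
  rfl

theorem card_le_improperChromaticNumber_fromEdgeSet_mul {n t K : ℕ} {ω : Sym2 (Fin n) → Bool}
    (h : ∀ S : Finset (Fin n), S.card = K + 1 → ω ∉ depEvent t S) :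
    n ≤ improperChromaticNumber (SimpleGraph.fromEdgeSet {e | ω e = true}) t * K := by
  have h1 := card_le_improperChromaticNumber_mul
    (G := SimpleGraph.fromEdgeSet {e | ω e = true}) (t := t) (K := K) fun S hS => ?_
  · rwa [Fintype.card_fin] at h1
  · by_contra! hlt
    obtain ⟨T, hTS, hT⟩ := Finset.exists_subset_card_eq (Nat.succ_le_of_lt hlt)
    exact h T hT (depEvent_anti hTS t ((isTDependent_fromEdgeSet_iff t S ω).1 hS))

theorem improperChromaticNumber_fromEdgeSet_le {n t k m : ℕ} {ω : Sym2 (Fin n) → Bool}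
    (hk : 0 < k) (h : ∀ U : Finset (Fin n), U.card = m → ∃ S ∈ U.powersetCard k,
      ω ∈ depEvent t S) :
    improperChromaticNumber (SimpleGraph.fromEdgeSet {e | ω e = true}) t ≤ n / k + m := by
  have h1 := improperChromaticNumber_le_of_forall_exists
    (G := SimpleGraph.fromEdgeSet {e | ω e = true}) (t := t) (m := m) hk fun U hU => ?_
  · rwa [Fintype.card_fin] at h1
  · obtain ⟨S, hS, hω⟩ := h U hU
    obtain ⟨hSU, hSk⟩ := Finset.mem_powersetCard.1 hS
    exact ⟨S, hSU, hSk, (isTDependent_fromEdgeSet_iff t S ω).2 hω⟩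

variable {p τ κ₀ κ : ℝ}

theorem exists_two_lt_of_threshold_lt (hp : p ∈ Set.Ioo (0 : ℝ) 1) (hτ : 0 ≤ τ) (hκ₀ : 0 < κ₀)
    (hτκ : τ / κ₀ < p) (hκeq : κ₀ * LambdaStar p (τ / κ₀) = 2) (hκ : κ₀ < κ) :
    ∃ s, 0 ≤ s ∧ 2 < -κ * Real.log (1 - p + p * Real.exp (-s)) - s * τ := by
  have hpos : 0 < κ - κ₀ := by linarith
  have hη : 0 < (κ - κ₀) / (κ * κ₀) := div_pos hpos (mul_pos (hκ₀.trans hκ) hκ₀)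
  obtain ⟨s, hs, h⟩ := exists_LambdaStar_sub_le hp ⟨by positivity, hτκ⟩ hη
  refine ⟨s, hs, ?_⟩
  have h1 := mul_le_mul_of_nonneg_left h (hκ₀.trans hκ).le
  have h2 : κ * (LambdaStar p (τ / κ₀) - (κ - κ₀) / (κ * κ₀)) = 2 + (κ - κ₀) / κ₀ := by
    have hΛ : LambdaStar p (τ / κ₀) = 2 / κ₀ := by
      rw [eq_div_iff hκ₀.ne', mul_comm, hκeq]
    have := (hκ₀.trans hκ).ne'
    rw [hΛ]
    field_simp
    ring
  have h3 : s * τ ≤ κ * (s * (τ / κ₀)) := by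
    have : κ * (s * (τ / κ₀)) = s * τ * (κ / κ₀) := by ring
    rw [this]
    exact le_mul_of_one_le_right (mul_nonneg hs hτ) ((one_le_div hκ₀).2 hκ.le)
  have h4 : 0 < (κ - κ₀) / κ₀ := div_pos hpos hκ₀
  linarith

theorem mul_LambdaStar_lt_two (hp : p ∈ Set.Ioo (0 : ℝ) 1) (hτ : 0 ≤ τ) (hκ0 : 0 < κ)
    (hκeq : κ₀ * LambdaStar p (τ / κ₀) = 2) (hκ : κ < κ₀) (hτκ : τ / κ < p) :
    κ * LambdaStar p (τ / κ) < 2 := by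
  have hκ₀ := hκ0.trans hκ
  have hle : τ / κ₀ ≤ τ / κ := div_le_div_of_nonneg_left hτ hκ0 hκ.le
  have h1 := LambdaStar_antitoneOn hp ⟨by positivity, hle.trans_lt hτκ⟩
    ⟨by positivity, hτκ⟩ hle
  have h2 : 0 < LambdaStar p (τ / κ₀) := (mul_pos_iff_of_pos_left hκ₀).1 (by linarith)
  calc κ * LambdaStar p (τ / κ) ≤ κ * LambdaStar p (τ / κ₀) := by gcongr
    _ < κ₀ * LambdaStar p (τ / κ₀) := by gcongr
    _ = 2 := hκeq

end Threshold

/-- Fix `0 < p < 1`, `τ ≥ 0`, and let `κ₀ = κ_p(τ)` be the unique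
`κ > τ/p` with `(κ/2)·Λ*(τ/κ) = 1`.  If `t(n)/ln n → τ`, then a.a.s.
`χ^{t(n)}(G(n,p)) = (1+o(1))·n/(κ₀·ln n)`. -/
theorem stmt13 (p : ℝ) (hp0 : 0 < p) (hp1 : p < 1) (τ : ℝ) (hτ : 0 ≤ τ)
    (κ₀ : ℝ) (hκ₀ : τ / p < κ₀) (hκeq : κ₀ / 2 * LambdaStar p (τ / κ₀) = 1)
    (t : ℕ → ℕ) (ht : Tendsto (fun n => (t n : ℝ) / Real.log n) atTop (nhds τ))
    (ε : ℝ) (hε : 0 < ε) :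
    Tendsto (fun n => erMeasure n p
        {G | (1 - ε) * ((n : ℝ) / (κ₀ * Real.log n)) ≤ (improperChromaticNumber G (t n) : ℝ) ∧
            (improperChromaticNumber G (t n) : ℝ) ≤ (1 + ε) * ((n : ℝ) / (κ₀ * Real.log n))})
      atTop (nhds 1) := by
  have hp : p ∈ Set.Ioo (0 : ℝ) 1 := ⟨hp0, hp1⟩
  have hp' : p ∈ Set.Icc (0 : ℝ) 1 := ⟨hp0.le, hp1.le⟩
  have hκ₀0 : 0 < κ₀ := lt_of_le_of_lt (by positivity) hκ₀
  have hτκ₀ : τ / κ₀ < p := by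
    rw [div_lt_iff₀ hκ₀0]
    rwa [div_lt_iff₀ hp0, mul_comm] at hκ₀
  have hκeq' : κ₀ * LambdaStar p (τ / κ₀) = 2 := by linarith
  have hlog := tendsto_log_natCast_atTop
  obtain ⟨κ₁, hκ₁0, hκ₁, hτκ₁, hκ₁ε⟩ :
      ∃ κ₁, 0 < κ₁ ∧ κ₁ < κ₀ ∧ τ / κ₁ < p ∧ 1 / κ₁ < (1 + ε) / κ₀ := by
    have hlt : max (τ / p) (κ₀ / (1 + ε)) < κ₀ :=
      max_lt hκ₀ (div_lt_self hκ₀0 (by linarith))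
    obtain ⟨κ₁, h1, h2⟩ := exists_between hlt
    rw [max_lt_iff] at h1
    have h0 : 0 < κ₁ := lt_of_le_of_lt (by positivity) h1.1
    refine ⟨κ₁, h0, h2, ?_, ?_⟩
    · rw [div_lt_iff₀ h0]
      have := h1.1
      rwa [div_lt_iff₀ hp0, mul_comm] at this
    · rw [div_lt_div_iff₀ h0 hκ₀0]
      have := h1.2
      rw [div_lt_iff₀ (by linarith)] at this
      linarith
  set κ₂ := κ₀ * (1 + ε) with hκ₂
  have hκ₂0 : κ₀ < κ₂ := lt_mul_of_one_lt_right hκ₀0 (by linarith)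
  obtain ⟨s, hs, hsκ⟩ := exists_two_lt_of_threshold_lt hp hτ hκ₀0 hτκ₀ hκeq' hκ₂0
  have hlog0 : ∀ n : ℕ, 0 ≤ Real.log n := fun n => Real.log_natCast_nonneg n
  have hk₁ := tendsto_div_log_of_abs_sub_le (κ := κ₁) (k := fun n => ⌈κ₁ * Real.log n⌉₊) fun n => by
    have h1 := Nat.le_ceil (κ₁ * Real.log n)
    have h2 := Nat.ceil_lt_add_one (mul_nonneg hκ₁0.le (hlog0 n))
    rw [abs_le]
    constructor <;> linarith
  have hk₂ := tendsto_div_log_of_abs_sub_le (κ := κ₂) (k := fun n => ⌊κ₂ * Real.log n⌋₊ + 1)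
    fun n => by
      have h1 := Nat.lt_floor_add_one (κ₂ * Real.log n)
      have h2 := Nat.floor_le (mul_nonneg (hκ₀0.trans hκ₂0).le (hlog0 n))
      push_cast
      rw [abs_le]
      constructor <;> linarith
  have hA := tendsto_real_exists_depEvent hp (hκ₀0.trans hκ₂0) hs hsκ ht hk₂
  have hB := tendsto_real_exists_forall_notMem_depEvent hp hτ hκ₁0 hτκ₁
    (mul_LambdaStar_lt_two hp hτ hκ₁0 hκeq' hκ₁ hτκ₁) ht hk₁
  simp only [erMeasure_eq_ofReal hp']
  rw [← ENNReal.ofReal_one]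
  refine ENNReal.tendsto_ofReal ?_
  have hcolours : ∀ᶠ n : ℕ in atTop, 0 < Real.log n ∧ (n : ℝ) / (κ₁ * Real.log n) +
      (n / Real.log n ^ 2 + 1) ≤ (1 + ε) * (n / (κ₀ * Real.log n)) := by
    have h1 : Tendsto (fun n : ℕ => 1 / κ₁ + ((Real.log n)⁻¹ + Real.log n / n)) atTop
        (nhds (1 / κ₁ + (0 + 0))) :=
      .const_add _ <| (tendsto_inv_atTop_zero.comp hlog).add <|
        Real.isLittleO_log_id_atTop.tendsto_div_nhds_zero.comp tendsto_natCast_atTop_atTop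
    rw [add_zero, add_zero] at h1
    filter_upwards [h1.eventually (gt_mem_nhds hκ₁ε), hlog.eventually_gt_atTop 0,
      eventually_gt_atTop 0] with n hn hL hn0
    have hn0' : (0 : ℝ) < n := by exact_mod_cast hn0
    have h2 := mul_le_mul_of_nonneg_left hn.le (by positivity : 0 ≤ (n : ℝ) / Real.log n)
    refine ⟨hL, le_trans (le_of_eq ?_) (h2.trans (le_of_eq ?_))⟩
    · field_simp
    · field_simp
  have hlim := (hA.add hB).const_sub 1
  rw [add_zero, sub_zero] at hlim
  refine tendsto_of_tendsto_of_tendsto_of_le_of_le' hlim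
    tendsto_const_nhds ?_ (Eventually.of_forall fun n => ?_)
  · filter_upwards [hcolours, eventually_gt_atTop 0] with n ⟨hL, hn⟩ hn0
    have := isProbabilityMeasure_bernoulliPi (P := fun _ : Sym2 (Fin n) => p) fun _ => hp'
    set A := {ω : Sym2 (Fin n) → Bool | ∃ S : Finset (Fin n),
      S.card = ⌊κ₂ * Real.log n⌋₊ + 1 ∧ ω ∈ depEvent (t n) S} with hAdef
    set B := {ω : Sym2 (Fin n) → Bool | ∃ U : Finset (Fin n),
      U.card = ⌈(n : ℝ) / Real.log n ^ 2⌉₊ ∧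
        ∀ S ∈ U.powersetCard ⌈κ₁ * Real.log n⌉₊, ω ∉ depEvent (t n) S} with hBdef
    have hAB := measureReal_union_le (μ := bernoulliPi fun _ : Sym2 (Fin n) => p) A B
    have hcompl := probReal_compl_eq_one_sub (μ := bernoulliPi fun _ : Sym2 (Fin n) => p)
      (s := A ∪ B) MeasurableSet.of_discrete
    refine le_trans ?_ (measureReal_mono (s₁ := (A ∪ B)ᶜ) fun ω hω => ?_)
    · rw [hcompl]
      linarith
    · rw [Set.mem_compl_iff, Set.mem_union, not_or] at hω
      obtain ⟨hωA, hωB⟩ := hω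
      simp only [hAdef, hBdef, Set.mem_ofPred_eq, not_exists, not_and, not_forall, not_not]
        at hωA hωB
      set χ := improperChromaticNumber (SimpleGraph.fromEdgeSet {e | ω e = true}) (t n) with hχ
      have hlow : n ≤ χ * ⌊κ₂ * Real.log n⌋₊ :=
        card_le_improperChromaticNumber_fromEdgeSet_mul hωA
      have hup : χ ≤ n / ⌈κ₁ * Real.log n⌉₊ + ⌈(n : ℝ) / Real.log n ^ 2⌉₊ :=
        improperChromaticNumber_fromEdgeSet_le (Nat.ceil_pos.2 (mul_pos hκ₁0 hL)) fun U hU => by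
          simpa using hωB U hU
      constructor
      · have h1 : (n : ℝ) ≤ χ * (κ₂ * Real.log n) := by
          calc (n : ℝ) ≤ χ * (⌊κ₂ * Real.log n⌋₊ : ℝ) := by exact_mod_cast hlow
            _ ≤ _ := by
              gcongr
              exact Nat.floor_le (mul_nonneg (hκ₀0.trans hκ₂0).le hL.le)
        have h2 : (n : ℝ) / (κ₀ * Real.log n) ≤ χ * (1 + ε) := by
          rw [div_le_iff₀ (mul_pos hκ₀0 hL)]
          linarith [show χ * (κ₂ * Real.log n) = χ * (1 + ε) * (κ₀ * Real.log n) by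
            rw [hκ₂]; ring]
        have hχ0 : (0 : ℝ) ≤ χ := χ.cast_nonneg
        rcases le_total 0 (1 - ε) with h | h
        · calc (1 - ε) * ((n : ℝ) / (κ₀ * Real.log n)) ≤ (1 - ε) * (χ * (1 + ε)) := by gcongr
            _ = χ * (1 - ε ^ 2) := by ring
            _ ≤ χ := mul_le_of_le_one_right hχ0 (by nlinarith)
        · exact (mul_nonpos_of_nonpos_of_nonneg h (by positivity)).trans hχ0
      · refine le_trans ?_ hn
        calc (χ : ℝ) ≤ ((n / ⌈κ₁ * Real.log n⌉₊ : ℕ) : ℝ) + ⌈(n : ℝ) / Real.log n ^ 2⌉₊ := by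
              exact_mod_cast hup
          _ ≤ n / (κ₁ * Real.log n) + (n / Real.log n ^ 2 + 1) := by
              refine add_le_add (Nat.cast_div_le.trans ?_)
                (Nat.ceil_lt_add_one (by positivity)).le
              gcongr
              exact Nat.le_ceil _
  · have := isProbabilityMeasure_bernoulliPi (P := fun _ : Sym2 (Fin n) => p) fun _ => hp'
    exact measureReal_le_one
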